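/- arXiv:2311.03968 — 6 statements merged into one kernel-verified Lean document; each statement's English description precedes it below -/
import Mathlib

section
/- Let γ ∈ (−1/2, 0] and let g be a continuously differentiable function on a compact interval J = [a, b], extended to all of ℝ by setting g(s) = 0 for s ∉ J. Then there is a constant C depending only on γ such that ‖g‖_{Ḣ^γ(ℝ)} ≤ C (b − a)^{1/2 − γ} sup_{s ∈ [a,b]} |g(s)|. -/
open MeasureTheory Real Set Filter Metric
open scoped FourierTransform ENNReal NNReal Topology

noncomputable section
/-- The homogeneous Sobolev norm `‖g‖_{Ḣ^γ(ℝ)} = (∫ |ξ|^{2γ} |ĝ(ξ)|² dξ)^{1/2}`,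
valued in `[0,∞]`. -/
def sobNorm (γ : ℝ) (g : ℝ → ℂ) : ℝ≥0∞ :=
  (∫⁻ ξ : ℝ, ENNReal.ofReal (|ξ| ^ (2 * γ)) * (‖𝓕 g ξ‖₊ : ℝ≥0∞) ^ 2) ^ ((1 : ℝ) / 2)

open scoped SchwartzMap in
lemma plancherel_aux (g : ℝ → ℂ) (h1 : Integrable g) (h2 : MemLp g 2) :
    ∫⁻ ξ, ‖𝓕 g ξ‖ₑ ^ 2 = ∫⁻ x, ‖g x‖ₑ ^ 2 := by
  have hcont : Continuous (𝓕 g) :=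
    VectorFourier.fourierIntegral_continuous Real.continuous_fourierChar
      (by exact continuous_inner) h1
  set G : Lp ℂ 2 (volume : Measure ℝ) := h2.toLp g with hG
  have key : ∀ᵐ x, 𝓕 g x = (𝓕 G : Lp ℂ 2 (volume : Measure ℝ)) x := by
    apply ae_eq_of_integral_contDiff_smul_eq hcont.locallyIntegrable
      ((Lp.memLp _).locallyIntegrable (by norm_num))
    intro φ hφ hc
    have hg₁ : HasCompactSupport (Complex.ofRealCLM ∘ φ) := hc.comp_left rfl
    have hg₂ : ContDiff ℝ ((⊤ : ℕ∞) : WithTop ℕ∞) (Complex.ofRealCLM ∘ φ) := by fun_prop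
    set ψ : 𝓢(ℝ, ℂ) := hg₁.toSchwartzMap hg₂ with hψ
    have e := congrArg (fun T : 𝓢'(ℝ, ℂ) => T ψ) (Lp.fourier_toTemperedDistribution_eq G)
    simp only [TemperedDistribution.fourier_apply, Lp.toTemperedDistribution_apply] at e
    have e2 : ∫ x, (𝓕 ψ) x • G x = ∫ x, (𝓕 ψ) x • g x := by
      apply integral_congr_ae
      filter_upwards [h2.coeFn_toLp] with x hx
      rw [hG, hx]
    have e3 : ∫ x, (𝓕 ψ) x • g x = ∫ x, ψ x • 𝓕 g x := by
      have := VectorFourier.integral_fourierIntegral_smul_eq_flip (μ := (volume : Measure ℝ))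
        (ν := (volume : Measure ℝ)) (L := innerₗ ℝ) (f := ψ) (g := g)
        Real.continuous_fourierChar (by exact continuous_inner) ψ.integrable h1
      rw [flip_innerₗ] at this
      rw [SchwartzMap.fourier_coe]
      exact this
    rw [e2, e3] at e
    simpa [hψ] using e
  have l1 : eLpNorm (𝓕 g) 2 volume = eLpNorm g 2 volume := by
    rw [eLpNorm_congr_ae key, ← eLpNorm_congr_ae h2.coeFn_toLp, ← Lp.enorm_def, ← Lp.enorm_def,
      ← hG, ← ofReal_norm, ← ofReal_norm, Lp.norm_fourier_eq]
  have h := congrArg (· ^ (2:ℝ)) l1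
  simp only [eLpNorm_eq_lintegral_rpow_enorm_toReal (p := 2) two_ne_zero ENNReal.ofNat_ne_top,
    ENNReal.toReal_ofNat, ← ENNReal.rpow_mul] at h
  norm_num at h
  exact h

lemma low_aux (r R : ℝ) (hr : -1 < r) (hR : 0 < R) :
    ∫⁻ x in Icc (-R) R, ENNReal.ofReal (|x| ^ r) ≤ ENNReal.ofReal (2 / (r + 1) * R ^ (r + 1)) := by
  have A : ∫⁻ x in Ioc 0 R, ENNReal.ofReal (|x| ^ r) = ENNReal.ofReal (R ^ (r + 1) / (r + 1)) := by
    have i := intervalIntegral.intervalIntegrable_rpow' (a := 0) (b := R) hr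
    rw [intervalIntegrable_iff_integrableOn_Ioc_of_le hR.le] at i
    have : ∫⁻ x in Ioc 0 R, ENNReal.ofReal (|x| ^ r) = ∫⁻ x in Ioc 0 R, ENNReal.ofReal (x ^ r) :=
      setLIntegral_congr_fun measurableSet_Ioc fun x hx => by simp only [abs_of_pos hx.1]
    rw [this, ← ofReal_integral_eq_lintegral_ofReal i, ← intervalIntegral.integral_of_le hR.le,
      integral_rpow (Or.inl hr), Real.zero_rpow (by linarith), sub_zero]
    filter_upwards [ae_restrict_mem measurableSet_Ioc] with x hx
    exact Real.rpow_nonneg hx.1.le _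
  have B : ∫⁻ x in Ico (-R) 0, ENNReal.ofReal (|x| ^ r) = ENNReal.ofReal (R ^ (r + 1) / (r + 1)) := by
    rw [← A, ← (Measure.measurePreserving_neg (volume : Measure ℝ)).setLIntegral_comp_preimage
      measurableSet_Ioc (by fun_prop)]
    simp
  have hs : Icc (-R) R ⊆ (Ico (-R) 0 ∪ {0}) ∪ Ioc 0 R := by
    intro x hx
    rcases lt_trichotomy x 0 with h | h | h
    · exact Or.inl (Or.inl ⟨hx.1, h⟩)
    · exact Or.inl (Or.inr h)
    · exact Or.inr ⟨h, hx.2⟩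
  calc _ ≤ ∫⁻ x in (Ico (-R) 0 ∪ {0}) ∪ Ioc 0 R, ENNReal.ofReal (|x| ^ r) := lintegral_mono_set hs
    _ ≤ ((∫⁻ x in Ico (-R) 0, ENNReal.ofReal (|x| ^ r)) + ∫⁻ x in {0}, ENNReal.ofReal (|x| ^ r))
        + ∫⁻ x in Ioc 0 R, ENNReal.ofReal (|x| ^ r) :=
        (lintegral_union_le _ _ _).trans (add_le_add_left (lintegral_union_le _ _ _) _)
    _ = _ := by
      rw [A, B, setLIntegral_measure_zero _ _ (by simp), add_zero, ← ENNReal.ofReal_add]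
      · congr 1; ring
      all_goals exact div_nonneg (Real.rpow_nonneg hR.le _) (by linarith)


/-- For `γ ∈ (-1/2, 0]` and `g` continuously differentiable on `J = [a,b]`
and vanishing outside `J`, one has `‖g‖_{Ḣ^γ} ≤ C (b-a)^{1/2-γ} sup_{[a,b]} |g|`. -/
theorem stmt1 (γ : ℝ) (hγ : γ ∈ Ioc (-(1 / 2) : ℝ) 0) :
    ∃ C : ℝ, ∀ (a b : ℝ), a ≤ b → ∀ g : ℝ → ℂ,
      ContDiffOn ℝ 1 g (Icc a b) → (∀ s ∉ Icc a b, g s = 0) →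
      sobNorm γ g ≤
        ENNReal.ofReal (C * (b - a) ^ ((1 : ℝ) / 2 - γ) * ⨆ s : Icc a b, ‖g s‖) := by
  obtain ⟨hγ1, hγ2⟩ := hγ
  have hD : 0 < 2 / (2 * γ + 1) + 1 := by
    have : 0 < 2 * γ + 1 := by linarith
    positivity
  refine ⟨√(2 / (2 * γ + 1) + 1), fun a b hab g hg h0 => ?_⟩
  set M := ⨆ s : Icc a b, ‖g s‖ with hM
  have hgc := hg.continuousOn
  have hbdd : BddAbove (range fun s : Icc a b => ‖g s‖) := by
    have := (isCompact_Icc.image_of_continuousOn hgc.norm).bddAbove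
    rwa [image_eq_range] at this
  have hM0 : 0 ≤ M := Real.iSup_nonneg fun _ => norm_nonneg _
  have hgM : ∀ s, ‖g s‖ ≤ M := fun s => by
    by_cases hs : s ∈ Icc a b
    · exact le_ciSup hbdd ⟨s, hs⟩
    · simpa [h0 s hs] using hM0
  have hind : g = (Icc a b).indicator g := by
    ext s
    by_cases hs : s ∈ Icc a b <;> simp only [hs, indicator_of_mem, indicator_of_notMem, not_false_eq_true]
    exact h0 s hs
  have hmeas : AEStronglyMeasurable g volume := by
    rw [hind]
    exact (aestronglyMeasurable_indicator_iff measurableSet_Icc).2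
      (hgc.aestronglyMeasurable measurableSet_Icc)
  have hint : Integrable g := by
    rw [hind]
    exact (integrable_indicator_iff measurableSet_Icc).2 (hgc.integrableOn_Icc)
  have htop : MemLp g ∞ volume := memLp_top_of_bound hmeas M (Eventually.of_forall hgM)
  have h2 : MemLp g 2 := by
    rw [hind, memLp_indicator_iff_restrict measurableSet_Icc]
    exact (htop.restrict _).mono_exponent le_top
  rcases hab.eq_or_lt with rfl | hlt
  · have : 𝓕 g = 0 := by
      ext ξ
      rw [Real.fourier_eq]
      apply integral_eq_zero_of_ae
      have : ∀ᵐ x : ℝ, x ≠ a := by simp [ae_iff]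
      filter_upwards [this] with x hx
      simp [h0 x (by simpa using hx)]
    simp [sobNorm, this]
  set l := b - a with hl
  have hl0 : 0 < l := sub_pos.2 hlt
  have hfour : ∀ ξ, ‖𝓕 g ξ‖ₑ ^ 2 ≤ ENNReal.ofReal ((l * M) ^ 2) := fun ξ => by
    have : ‖𝓕 g ξ‖ ≤ l * M := by
      refine (VectorFourier.norm_fourierIntegral_le_integral_norm _ _ _ _ _).trans ?_
      have : ∀ x, ‖g x‖ ≤ (Icc a b).indicator (fun _ => M) x := fun x => by
        by_cases hs : x ∈ Icc a b
        · simpa [hs] using hgM x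
        · simp [hs, h0 x hs]
      refine (integral_mono hint.norm ((integrable_indicator_iff measurableSet_Icc).2
        (by simp)) this).trans ?_
      rw [integral_indicator measurableSet_Icc]
      simp [hlt.le, hl]
    rw [← ofReal_norm, ← ENNReal.ofReal_pow (norm_nonneg _)]
    gcongr
  have hL2 : ∫⁻ x, ‖𝓕 g x‖ₑ ^ 2 ≤ ENNReal.ofReal (l * M ^ 2) := by
    rw [plancherel_aux g hint h2]
    calc _ ≤ ∫⁻ x, (Icc a b).indicator (fun _ => ENNReal.ofReal (M ^ 2)) x := by
          apply lintegral_mono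
          intro x
          by_cases hs : x ∈ Icc a b
          · simp only [hs, indicator_of_mem]
            rw [← ofReal_norm, ← ENNReal.ofReal_pow (norm_nonneg _)]
            gcongr
            exact hgM x
          · simp [hs, h0 x hs]
      _ = _ := by
          rw [lintegral_indicator measurableSet_Icc]
          simp only [lintegral_const, MeasurableSet.univ, Measure.restrict_apply, univ_inter,
            Real.volume_Icc]
          rw [← ENNReal.ofReal_mul (by positivity), mul_comm]
  set R := l⁻¹ with hR
  have hR0 : 0 < R := inv_pos.2 hl0
  have main : ∫⁻ ξ : ℝ, ENNReal.ofReal (|ξ| ^ (2 * γ)) * ‖𝓕 g ξ‖ₑ ^ 2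
      ≤ ENNReal.ofReal ((√(2 / (2 * γ + 1) + 1) * l ^ ((1 : ℝ) / 2 - γ) * M) ^ 2) := by
    rw [← lintegral_add_compl _ (measurableSet_Icc (a := -R) (b := R))]
    have P1 : ∫⁻ ξ in Icc (-R) R, ENNReal.ofReal (|ξ| ^ (2 * γ)) * ‖𝓕 g ξ‖ₑ ^ 2
        ≤ ENNReal.ofReal (2 / (2 * γ + 1) * R ^ (2 * γ + 1)) * ENNReal.ofReal ((l * M) ^ 2) := by
      refine (lintegral_mono fun ξ => mul_le_mul_right (hfour ξ) _).trans ?_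
      rw [lintegral_mul_const' _ _ ENNReal.ofReal_ne_top]
      gcongr
      exact low_aux _ _ (by linarith) hR0
    have P2 : ∫⁻ ξ in (Icc (-R) R)ᶜ, ENNReal.ofReal (|ξ| ^ (2 * γ)) * ‖𝓕 g ξ‖ₑ ^ 2
        ≤ ENNReal.ofReal (R ^ (2 * γ)) * ENNReal.ofReal (l * M ^ 2) := by
      calc _ ≤ ∫⁻ ξ in (Icc (-R) R)ᶜ, ENNReal.ofReal (R ^ (2 * γ)) * ‖𝓕 g ξ‖ₑ ^ 2 := by
            apply setLIntegral_mono' measurableSet_Icc.compl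
            intro ξ hξ
            gcongr ENNReal.ofReal ?_ * _
            apply Real.rpow_le_rpow_of_nonpos hR0 _ (by linarith)
            rw [mem_compl_iff, mem_Icc, ← abs_le, not_le] at hξ
            exact hξ.le
        _ ≤ ∫⁻ ξ, ENNReal.ofReal (R ^ (2 * γ)) * ‖𝓕 g ξ‖ₑ ^ 2 := setLIntegral_le_lintegral _ _
        _ ≤ _ := by
            rw [lintegral_const_mul' _ _ ENNReal.ofReal_ne_top]
            gcongr
    refine (add_le_add P1 P2).trans (le_of_eq ?_)
    have : 0 < 2 * γ + 1 := by linarith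
    rw [← ENNReal.ofReal_mul (by positivity), ← ENNReal.ofReal_mul (by positivity),
      ← ENNReal.ofReal_add (by positivity) (by positivity)]
    congr 1
    rw [mul_pow, mul_pow, mul_pow, Real.sq_sqrt hD.le, ← Real.rpow_natCast (l ^ _), ← Real.rpow_mul hl0.le,
      hR, Real.inv_rpow hl0.le, Real.inv_rpow hl0.le, ← Real.rpow_neg hl0.le,
      ← Real.rpow_neg hl0.le]
    have e1 : l ^ (-(2 * γ + 1)) * l ^ 2 = l ^ ((1 / 2 - γ) * ((2:ℕ):ℝ)) := by
      rw [← Real.rpow_natCast l 2, ← Real.rpow_add hl0]; congr 1; push_cast; ring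
    have e2 : l ^ (-(2 * γ)) * l = l ^ ((1 / 2 - γ) * ((2:ℕ):ℝ)) := by
      nth_rw 2 [← Real.rpow_one l]
      rw [← Real.rpow_add hl0]; congr 1; push_cast; ring
    rw [add_mul, add_mul, one_mul]
    nth_rw 1 [← e1]
    rw [← e2]; ring
  unfold sobNorm
  calc _ ≤ (ENNReal.ofReal ((√(2 / (2 * γ + 1) + 1) * l ^ ((1 : ℝ) / 2 - γ) * M) ^ 2)) ^ ((1:ℝ)/2) :=
        ENNReal.rpow_le_rpow main (by norm_num)
    _ = _ := by
      rw [ENNReal.ofReal_rpow_of_nonneg (by positivity) (by norm_num), ← Real.sqrt_eq_rpow,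
        Real.sqrt_sq (by positivity)]
end
end

section
/- Let γ ∈ (0, 1/2) and let g be a continuously differentiable function on a compact interval J = [a, b], extended to all of ℝ by setting g(s) = 0 for s ∉ J. Then there is a constant C depending only on γ such that ‖g‖_{Ḣ^γ(ℝ)} ≤ C (b − a)^{1/2 − γ} ( sup_{s ∈ [a,b]} |g(s)| + (b − a) sup_{s ∈ [a,b]} |g′(s)| ). -/
open MeasureTheory Real Set Filter Metric
open scoped FourierTransform ENNReal NNReal Topology

noncomputable section
lemma fourier_bounds_aux (a b : ℝ) (hab : a < b) (g : ℝ → ℂ) (hg : ContDiffOn ℝ 1 g (Icc a b))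
    (h0 : ∀ s ∉ Icc a b, g s = 0) (A B : ℝ) (hA : ∀ s ∈ Icc a b, ‖g s‖ ≤ A)
    (hB : ∀ s ∈ Icc a b, ‖derivWithin g (Icc a b) s‖ ≤ B) (ξ : ℝ) :
    ‖𝓕 g ξ‖ ≤ (b - a) * A ∧ 2 * π * |ξ| * ‖𝓕 g ξ‖ ≤ 2 * A + (b - a) * B := by
  set v : ℝ → ℂ := fun x => Complex.exp (↑(-2 * π * x * ξ) * Complex.I) with hv
  have hvn : ∀ x, ‖v x‖ = 1 := fun x => Complex.norm_exp_ofReal_mul_I _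
  have hF : 𝓕 g ξ = ∫ x in a..b, g x * v x := by
    rw [fourier_real_eq_integral_exp_smul, intervalIntegral.integral_of_le hab.le,
      ← integral_Icc_eq_integral_Ioc, setIntegral_eq_integral_of_forall_compl_eq_zero]
    · simp [hv, mul_comm]
    · intro x hx
      rw [h0 x hx, zero_mul]
  have hL : |b - a| = b - a := abs_of_pos (sub_pos.2 hab)
  have hsub : ∀ x ∈ uIoc a b, x ∈ Icc a b := fun x hx => by
    rw [uIoc_of_le hab.le] at hx
    exact Ioc_subset_Icc_self hx
  constructor
  · rw [hF]
    have := intervalIntegral.norm_integral_le_of_norm_le_const (a := a) (b := b)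
      (f := fun x => g x * v x) (C := A) (fun x hx => by
        rw [norm_mul, hvn, mul_one]; exact hA x (hsub x hx))
    rw [hL] at this
    linarith
  · set c : ℂ := ↑(-2 * π * ξ) * Complex.I with hc
    have hcn : ‖c‖ = 2 * π * |ξ| := by
      rw [hc, norm_mul, Complex.norm_I, Complex.norm_real, norm_mul, norm_mul]
      simp [abs_of_pos pi_pos]
    have hvd : ∀ x, HasDerivAt v (v x * c) x := by
      intro x
      have h1 : HasDerivAt (fun x : ℝ => ((-2 * π * x * ξ : ℝ) : ℂ) * Complex.I) c x := by
        have h2 : HasDerivAt (fun x : ℝ => (-2 * π * x * ξ : ℝ)) (-2 * π * ξ) x := by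
          simpa using ((hasDerivAt_id x).const_mul (-2 * π)).mul_const ξ
        exact h2.ofReal_comp.mul_const _
      exact h1.cexp
    have hvc : Continuous v := by
      rw [hv]; fun_prop
    have hud : UniqueDiffOn ℝ (Icc a b) := uniqueDiffOn_Icc hab
    have hdc : ContinuousOn (derivWithin g (Icc a b)) (Icc a b) :=
      hg.continuousOn_derivWithin hud le_rfl
    have key := intervalIntegral.integral_mul_deriv_eq_deriv_mul_of_hasDerivWithinAt
      (a := a) (b := b) (u := g) (v := v) (u' := derivWithin g (Icc a b)) (v' := fun x => v x * c)
      (by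
        rw [uIcc_of_le hab.le]
        intro x hx
        exact (hg.differentiableOn one_ne_zero x hx).hasDerivWithinAt)
      (fun x _ => (hvd x).hasDerivWithinAt)
      (ContinuousOn.intervalIntegrable (by rwa [uIcc_of_le hab.le]))
      ((hvc.mul continuous_const).intervalIntegrable _ _)
    have e : ∫ x in a..b, g x * (v x * c) = (𝓕 g ξ) * c := by
      rw [hF, ← intervalIntegral.integral_mul_const]
      simp only [mul_assoc]
    rw [e] at key
    have h3 := intervalIntegral.norm_integral_le_of_norm_le_const (a := a) (b := b)
      (f := fun x => derivWithin g (Icc a b) x * v x) (C := B) (fun x hx => by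
        rw [norm_mul, hvn, mul_one]; exact hB x (hsub x hx))
    rw [hL] at h3
    have h4 : ‖𝓕 g ξ * c‖ ≤ A + A + B * (b - a) := by
      rw [key]
      refine (norm_sub_le _ _).trans (add_le_add ((norm_sub_le _ _).trans (add_le_add ?_ ?_)) h3)
      · rw [norm_mul, hvn, mul_one]; exact hA b (right_mem_Icc.2 hab.le)
      · rw [norm_mul, hvn, mul_one]; exact hA a (left_mem_Icc.2 hab.le)
    rw [norm_mul, hcn] at h4
    linarith

lemma weight_aux (γ L M F ξ : ℝ) (hγ : 0 < γ) (hL : 0 < L) (hF : 0 ≤ F)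
    (h1 : F ≤ L * M) (h2 : F * |ξ| ≤ M) :
    |ξ| ^ (2 * γ) * F ^ 2 ≤ 4 * L ^ (2 - 2 * γ) * M ^ 2 * (1 + ‖L * ξ‖) ^ (-(2 - 2 * γ)) := by
  have hn : ‖L * ξ‖ = L * |ξ| := by rw [norm_mul, norm_eq_abs, norm_eq_abs, abs_of_pos hL]
  rw [hn]
  have hx := abs_nonneg ξ
  set t := 1 + L * |ξ| with ht
  have ht0 : 0 < t := by positivity
  have hFt : F * t ≤ 2 * L * M := by
    have := mul_le_mul_of_nonneg_left h2 hL.le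
    rw [ht]; nlinarith
  have hF2 : F ^ 2 ≤ (2 * L * M) ^ 2 / t ^ 2 := by
    rw [le_div_iff₀ (by positivity), ← mul_pow]
    exact pow_le_pow_left₀ (by positivity) hFt 2
  have hxi : |ξ| ^ (2 * γ) ≤ t ^ (2 * γ) / L ^ (2 * γ) := by
    rw [← div_rpow ht0.le hL.le]
    apply rpow_le_rpow hx _ (by positivity)
    rw [le_div_iff₀ hL, ht]; linarith
  have et : t ^ (-(2 - 2 * γ)) = t ^ (2 * γ) / t ^ 2 := by
    rw [neg_sub, rpow_sub ht0, rpow_two]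
  have eL : L ^ (2 - 2 * γ) = L ^ 2 / L ^ (2 * γ) := by
    rw [rpow_sub hL, rpow_two]
  calc _ ≤ (t ^ (2 * γ) / L ^ (2 * γ)) * ((2 * L * M) ^ 2 / t ^ 2) := by gcongr
    _ = _ := by rw [et, eL]; ring

/-- For `γ ∈ (0, 1/2)` and `g` continuously differentiable on `J = [a,b]`
and vanishing outside `J`,
`‖g‖_{Ḣ^γ} ≤ C (b-a)^{1/2-γ} (sup_{[a,b]} |g| + (b-a) sup_{[a,b]} |g'|)`. -/
theorem stmt2 (γ : ℝ) (hγ : γ ∈ Ioo (0 : ℝ) (1 / 2)) :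
    ∃ C : ℝ, ∀ (a b : ℝ), a ≤ b → ∀ g : ℝ → ℂ,
      ContDiffOn ℝ 1 g (Icc a b) → (∀ s ∉ Icc a b, g s = 0) →
      sobNorm γ g ≤
        ENNReal.ofReal (C * (b - a) ^ ((1 : ℝ) / 2 - γ) *
          ((⨆ s : Icc a b, ‖g s‖) +
            (b - a) * ⨆ s : Icc a b, ‖derivWithin g (Icc a b) s‖)) := by
  obtain ⟨hγ0, hγ1⟩ := hγ
  set I : ℝ := ∫ x : ℝ, (1 + ‖x‖) ^ (-(2 - 2 * γ)) with hI
  have hint : Integrable (fun x : ℝ => (1 + ‖x‖) ^ (-(2 - 2 * γ))) :=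
    integrable_one_add_norm (by simp; linarith)
  have hI0 : 0 ≤ I := integral_nonneg fun x => by positivity
  refine ⟨2 * √I, fun a b hab g hg h0 => ?_⟩
  rcases hab.eq_or_lt with rfl | hab
  · have hz : ∀ ξ, 𝓕 g ξ = 0 := by
      intro ξ
      rw [fourier_real_eq_integral_exp_smul, ← setIntegral_eq_integral_of_forall_compl_eq_zero
        (s := Icc a a)]
      · simp
      · intro x hx
        rw [h0 x hx, smul_zero]
    simp [sobNorm, hz]
  have hL : 0 < b - a := sub_pos.2 hab
  set L := b - a with hLdef
  set A : ℝ := ⨆ s : Icc a b, ‖g s‖ with hA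
  set B : ℝ := ⨆ s : Icc a b, ‖derivWithin g (Icc a b) s‖ with hB
  have hA0 : 0 ≤ A := Real.iSup_nonneg fun _ => norm_nonneg _
  have hB0 : 0 ≤ B := Real.iSup_nonneg fun _ => norm_nonneg _
  have bdd : ∀ f : ℝ → ℂ, ContinuousOn f (Icc a b) →
      ∀ s ∈ Icc a b, ‖f s‖ ≤ ⨆ s : Icc a b, ‖f s‖ := by
    intro f hf s hs
    refine le_ciSup (f := fun s : Icc a b => ‖f s‖) ?_ ⟨s, hs⟩
    exact (isCompact_range (continuousOn_iff_continuous_domRestrict.1 hf).norm).bddAbove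
  have hbA := bdd g hg.continuousOn
  have hbB := bdd _ (hg.continuousOn_derivWithin (uniqueDiffOn_Icc hab) le_rfl)
  set M := A + L * B with hM
  have hM0 : 0 ≤ M := by positivity
  have hpt : ∀ ξ : ℝ, |ξ| ^ (2 * γ) * ‖𝓕 g ξ‖ ^ 2 ≤
      4 * L ^ (2 - 2 * γ) * M ^ 2 * (1 + ‖L * ξ‖) ^ (-(2 - 2 * γ)) := by
    intro ξ
    obtain ⟨k1, k2⟩ := fourier_bounds_aux a b hab g hg h0 A B hbA hbB ξ
    have hLB : 0 ≤ L * B := by positivity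
    refine weight_aux γ L M _ ξ hγ0 hL (norm_nonneg _) (k1.trans ?_) ?_
    · exact mul_le_mul_of_nonneg_left (by linarith) hL.le
    · have hp := Real.pi_gt_three
      have : 0 ≤ |ξ| * ‖𝓕 g ξ‖ := by positivity
      nlinarith
  set X := 2 * √I * L ^ ((1 : ℝ) / 2 - γ) * M with hX
  have hX0 : 0 ≤ X := by positivity
  have hint2 : Integrable (fun ξ : ℝ =>
      4 * L ^ (2 - 2 * γ) * M ^ 2 * (1 + ‖L * ξ‖) ^ (-(2 - 2 * γ))) :=
    (hint.comp_mul_left' hL.ne').const_mul _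
  have hval : ∫ ξ : ℝ, 4 * L ^ (2 - 2 * γ) * M ^ 2 * (1 + ‖L * ξ‖) ^ (-(2 - 2 * γ)) = X ^ 2 := by
    rw [integral_const_mul, Measure.integral_comp_mul_left
      (fun x : ℝ => (1 + ‖x‖) ^ (-(2 - 2 * γ))), ← hI, smul_eq_mul, abs_of_pos (by positivity), hX]
    have e1 : (L ^ ((1 : ℝ) / 2 - γ)) ^ 2 = L ^ (2 - 2 * γ) * L⁻¹ := by
      rw [← rpow_natCast, ← rpow_mul hL.le, ← rpow_neg_one, ← rpow_add hL]
      congr 1; push_cast; ring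
    rw [mul_pow, mul_pow, mul_pow, e1, sq_sqrt hI0]
    ring
  have hle : ∫⁻ ξ : ℝ, ENNReal.ofReal (|ξ| ^ (2 * γ)) * (‖𝓕 g ξ‖₊ : ℝ≥0∞) ^ 2 ≤
      ENNReal.ofReal (X ^ 2) := by
    rw [← hval, ofReal_integral_eq_lintegral_ofReal hint2
      (Eventually.of_forall fun ξ => by positivity)]
    refine lintegral_mono fun ξ => ?_
    have e : (‖𝓕 g ξ‖₊ : ℝ≥0∞) = ENNReal.ofReal ‖𝓕 g ξ‖ := (ofReal_norm _).symm
    rw [e, ← ENNReal.ofReal_pow (norm_nonneg _), ← ENNReal.ofReal_mul (by positivity)]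
    exact ENNReal.ofReal_le_ofReal (hpt ξ)
  unfold sobNorm
  refine (ENNReal.rpow_le_rpow hle (by norm_num)).trans (le_of_eq ?_)
  rw [ENNReal.ofReal_rpow_of_nonneg (by positivity) (by norm_num), ← sqrt_eq_rpow, sqrt_sq hX0]
end
end

section
/- Let d ≥ 3 be an odd integer and β ∈ (1/2, 3/2). There exists a constant C = C(d, β) such that for every k ∈ ℤ, every r > 0 and every t ∈ ℝ, the function h defined by h(s) = P_{(d−3)/2}((s−t)/r) for s ∈ ([−2^{k+1}, −2^k] ∪ [2^k, 2^{k+1}]) ∩ [t − r, t + r] and h(s) = 0 otherwise, satisfies ‖h‖_{Ḣ^{1−β}(ℝ)} ≤ C (min{r, 2^k})^{β − 1/2}. -/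
open MeasureTheory Real Set Filter Metric
open scoped FourierTransform ENNReal NNReal Topology

noncomputable section

/-- The mixed space-time norm `‖u‖_{L^p L^q(I × ℝ^d)}`, valued in `[0,∞]`. -/
def mixedNorm (d : ℕ) (p q : ℝ) (I : Set ℝ)
    (u : EuclideanSpace ℝ (Fin d) → ℝ → ℝ) : ℝ≥0∞ :=
  (∫⁻ t in I, (∫⁻ x : EuclideanSpace ℝ (Fin d),
      (ENNReal.ofReal |u x t|) ^ q) ^ (p / q)) ^ (1 / p)

/-- `χ_j u` : the function `u` multiplied by the characteristic function of
`Ω_j = {(x,t) : |t| + 2^j ≤ |x| < |t| + 2^{j+1}}`. -/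
def chiO (d : ℕ) (j : ℤ) (u : EuclideanSpace ℝ (Fin d) → ℝ → ℝ) :
    EuclideanSpace ℝ (Fin d) → ℝ → ℝ := fun x t =>
  if |t| + (2 : ℝ) ^ j ≤ ‖x‖ ∧ ‖x‖ < |t| + (2 : ℝ) ^ (j + 1) then u x t else 0

/-- The Legendre polynomial `P_m(z) = (1/(2^m m!)) (d/dz)^m (z²-1)^m`. -/
def legendreP (m : ℕ) (z : ℝ) : ℝ :=
  (1 / ((2 : ℝ) ^ m * (m.factorial : ℝ))) *
    iteratedDeriv m (fun y : ℝ => (y ^ 2 - 1) ^ m) z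

/-- The set `J_k = [-2^{k+1}, -2^k] ∪ [2^k, 2^{k+1}]`. -/
def Iset (k : ℤ) : Set ℝ :=
  Icc (-(2 : ℝ) ^ (k + 1)) (-(2 : ℝ) ^ k) ∪ Icc ((2 : ℝ) ^ k) ((2 : ℝ) ^ (k + 1))


lemma legendre_contDiff (m : ℕ) : ContDiff ℝ 1 (legendreP m) := by
  unfold legendreP
  refine contDiff_const.mul ?_
  have h : ContDiff ℝ (1 + m) (fun y : ℝ => (y ^ 2 - 1) ^ m) := by fun_prop
  rw [iteratedDeriv_eq_iterate]
  exact ContDiff.iterate_deriv' 1 m (by exact_mod_cast h)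

lemma piece_bound (p : ℝ → ℝ) (hp : ContDiff ℝ 1 p) :
    ∃ B : ℝ, 0 ≤ B ∧ ∀ (r t a b ξ : ℝ), 0 < r → t - r ≤ a → b ≤ t + r →
      ‖∫ s in Icc a b, Complex.exp (((-2 * π * (s * ξ) : ℝ) : ℂ) * Complex.I) * ((p ((s - t) / r) : ℝ) : ℂ)‖
        ≤ B * max (b - a) 0 ∧
      |ξ| * ‖∫ s in Icc a b, Complex.exp (((-2 * π * (s * ξ) : ℝ) : ℂ) * Complex.I) * ((p ((s - t) / r) : ℝ) : ℂ)‖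
        ≤ B := by
  have hp' : Continuous (deriv p) := hp.continuous_deriv le_rfl
  obtain ⟨M, hM⟩ := isCompact_Icc.exists_bound_of_continuousOn (s := Icc (-1:ℝ) 1) hp.continuous.continuousOn
  obtain ⟨N, hN⟩ := isCompact_Icc.exists_bound_of_continuousOn (s := Icc (-1:ℝ) 1) hp'.continuousOn
  have hM0 : 0 ≤ M := (norm_nonneg _).trans (hM 0 (by constructor <;> norm_num))
  have hN0 : 0 ≤ N := (norm_nonneg _).trans (hN 0 (by constructor <;> norm_num))
  refine ⟨2 * M + 2 * N, by positivity, ?_⟩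
  intro r t a b ξ hr ha hb
  rcases lt_or_ge b a with hab | hab
  · rw [Icc_eq_empty (not_le.mpr hab)]
    simp only [Measure.restrict_empty, integral_zero_measure, norm_zero, mul_zero]
    exact ⟨by positivity, by positivity⟩
  have hmem : ∀ s ∈ Icc a b, (s - t) / r ∈ Icc (-1:ℝ) 1 := by
    intro s hs
    constructor
    · rw [le_div_iff₀ hr]; linarith [hs.1]
    · rw [div_le_iff₀ hr]; linarith [hs.2]
  rw [integral_Icc_eq_integral_Ioc, ← intervalIntegral.integral_of_le hab]
  have hne : ∀ x : ℝ, ‖Complex.exp ((x : ℂ) * Complex.I)‖ = 1 := Complex.norm_exp_ofReal_mul_I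
  constructor
  · have h1 := intervalIntegral.norm_integral_le_of_norm_le_const (a := a) (b := b) (C := 2 * M + 2 * N)
      (f := fun s : ℝ => Complex.exp (((-2 * π * (s * ξ) : ℝ) : ℂ) * Complex.I) * ((p ((s - t) / r) : ℝ) : ℂ)) ?_
    · rw [abs_of_nonneg (by linarith)] at h1
      exact h1.trans (by gcongr; exact le_max_left _ _)
    · intro s hs
      rw [uIoc_of_le hab] at hs
      rw [norm_mul, hne, one_mul, Complex.norm_real]
      have := hM _ (hmem s ⟨hs.1.le, hs.2⟩)
      linarith
  · rcases eq_or_ne ξ 0 with rfl | hξ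
    · rw [abs_zero, zero_mul]; positivity
    set c : ℂ := ((-2 * π * ξ : ℝ) : ℂ) * Complex.I with hc
    have hc0 : c ≠ 0 := by
      rw [hc]; refine mul_ne_zero ?_ Complex.I_ne_zero
      exact Complex.ofReal_ne_zero.mpr (mul_ne_zero (mul_ne_zero (by norm_num) Real.pi_ne_zero) hξ)
    have hcn : |ξ| ≤ ‖c‖ := by
      rw [hc, norm_mul, Complex.norm_I, mul_one, Complex.norm_real, norm_mul, Real.norm_eq_abs, Real.norm_eq_abs]
      have : (1:ℝ) ≤ |-2 * π| := by
        rw [abs_of_neg (by linarith [Real.pi_pos])]; linarith [Real.pi_gt_three]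
      nlinarith [abs_nonneg ξ]
    have he : ∀ s : ℝ, ((-2 * π * (s * ξ) : ℝ) : ℂ) * Complex.I = c * s := by
      intro s; rw [hc]; push_cast; ring
    have hes : ∀ s : ℝ, ‖Complex.exp (c * s)‖ = 1 := by
      intro s; rw [← he]; exact hne _
    simp_rw [he]
    have hu : ∀ s : ℝ, HasDerivAt (fun s : ℝ => ((p ((s - t) / r) : ℝ) : ℂ))
        ((deriv p ((s - t) / r) * (1 / r) : ℝ) : ℂ) s := by
      intro s
      have h1 : HasDerivAt (fun s : ℝ => (s - t) / r) (1 / r) s :=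
        ((hasDerivAt_id s).sub_const t).div_const r
      have h2 : HasDerivAt p (deriv p ((s - t) / r)) ((s - t) / r) :=
        (hp.differentiable one_ne_zero).differentiableAt.hasDerivAt
      exact (h2.comp s h1).ofReal_comp
    have hv : ∀ s : ℝ, HasDerivAt (fun s : ℝ => Complex.exp (c * s) / c) (Complex.exp (c * s)) s := by
      intro s
      have h1 : HasDerivAt (fun s : ℝ => c * (s : ℂ)) (c * 1) s :=
        (HasDerivAt.ofReal_comp (hasDerivAt_id s)).const_mul c
      have h2 := (h1.cexp).div_const c
      rwa [mul_one, mul_div_cancel_right₀ _ hc0] at h2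
    have hibp := intervalIntegral.integral_mul_deriv_eq_deriv_mul (a := a) (b := b)
      (fun s _ => hu s) (fun s _ => hv s)
      (Continuous.intervalIntegrable (by fun_prop) _ _)
      (Continuous.intervalIntegrable (by fun_prop) _ _)
    have hcomm : (∫ s in a..b, Complex.exp (c * s) * ((p ((s - t) / r) : ℝ) : ℂ))
        = ∫ s in a..b, ((p ((s - t) / r) : ℝ) : ℂ) * Complex.exp (c * s) := by
      simp_rw [mul_comm]
    rw [hcomm, hibp]
    have hcp : 0 < ‖c‖ := norm_pos_iff.mpr hc0
    have hb1 : ∀ s ∈ Icc a b, ‖((p ((s - t) / r) : ℝ) : ℂ) * (Complex.exp (c * s) / c)‖ ≤ M / ‖c‖ := by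
      intro s hs
      rw [norm_mul, norm_div, hes, Complex.norm_real, mul_one_div]
      gcongr
      exact hM _ (hmem s hs)
    have hb2 : ‖∫ s in a..b, ((deriv p ((s - t) / r) * (1 / r) : ℝ) : ℂ) * (Complex.exp (c * s) / c)‖
        ≤ 2 * N / ‖c‖ := by
      refine (intervalIntegral.norm_integral_le_of_norm_le_const (C := N / r / ‖c‖) ?_).trans ?_
      · intro s hs
        rw [uIoc_of_le hab] at hs
        rw [norm_mul, norm_div, hes, Complex.norm_real, mul_one_div, norm_mul, norm_div, norm_one,
          mul_one_div, Real.norm_of_nonneg hr.le]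
        gcongr
        exact hN _ (hmem s ⟨hs.1.le, hs.2⟩)
      · rw [abs_of_nonneg (by linarith)]
        calc N / r / ‖c‖ * (b - a) ≤ N / r / ‖c‖ * (2 * r) := by gcongr; linarith
          _ = 2 * N / ‖c‖ := by field_simp
    calc |ξ| * _ ≤ ‖c‖ * (M / ‖c‖ + M / ‖c‖ + 2 * N / ‖c‖) := by
          gcongr
          refine (norm_sub_le _ _).trans ?_
          gcongr
          refine (norm_sub_le _ _).trans ?_
          exact add_le_add (hb1 b ⟨hab, le_rfl⟩) (hb1 a ⟨le_rfl, hab⟩)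
      _ = 2 * M + 2 * N := by field_simp; ring

lemma fourier_bound (p : ℝ → ℝ) (hp : ContDiff ℝ 1 p) :
    ∃ A : ℝ, 0 ≤ A ∧ ∀ (k : ℤ) (r t ξ : ℝ), 0 < r →
      ‖𝓕 ((Iset k ∩ Icc (t - r) (t + r)).indicator
          (fun s => ((p ((s - t) / r) : ℝ) : ℂ))) ξ‖ ≤ A * min r ((2:ℝ) ^ k) ∧
      |ξ| * ‖𝓕 ((Iset k ∩ Icc (t - r) (t + r)).indicator
          (fun s => ((p ((s - t) / r) : ℝ) : ℂ))) ξ‖ ≤ A := by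
  obtain ⟨B, hB0, hB⟩ := piece_bound p hp
  refine ⟨4 * B, by positivity, ?_⟩
  intro k r t ξ hr
  have hk : (0:ℝ) < 2 ^ k := by positivity
  have hk1 : (2:ℝ) ^ (k + 1) = 2 * 2 ^ k := by rw [zpow_add_one₀ two_ne_zero]; ring
  set K : ℝ := 2 ^ k with hK
  have hset : Iset k ∩ Icc (t - r) (t + r) =
      Icc (max (-(2 * K)) (t - r)) (min (-K) (t + r)) ∪ Icc (max K (t - r)) (min (2 * K) (t + r)) := by
    unfold Iset
    rw [hk1, union_inter_distrib_right, Icc_inter_Icc, Icc_inter_Icc]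
  have hmeas : MeasurableSet (Icc (max (-(2 * K)) (t - r)) (min (-K) (t + r)) ∪ Icc (max K (t - r)) (min (2 * K) (t + r))) :=
    measurableSet_Icc.union measurableSet_Icc
  have hcont : Continuous (fun s : ℝ => Complex.exp (((-2 * π * (s * ξ) : ℝ) : ℂ) * Complex.I) * ((p ((s - t) / r) : ℝ) : ℂ)) := by
    have := hp.continuous
    fun_prop
  have hF : 𝓕 ((Iset k ∩ Icc (t - r) (t + r)).indicator
          (fun s => ((p ((s - t) / r) : ℝ) : ℂ))) ξ =
      (∫ s in Icc (max (-(2 * K)) (t - r)) (min (-K) (t + r)), Complex.exp (((-2 * π * (s * ξ) : ℝ) : ℂ) * Complex.I) * ((p ((s - t) / r) : ℝ) : ℂ)) +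
      ∫ s in Icc (max K (t - r)) (min (2 * K) (t + r)), Complex.exp (((-2 * π * (s * ξ) : ℝ) : ℂ) * Complex.I) * ((p ((s - t) / r) : ℝ) : ℂ) := by
    rw [hset, Real.fourier_eq', ← setIntegral_union _ measurableSet_Icc
      hcont.continuousOn.integrableOn_Icc hcont.continuousOn.integrableOn_Icc,
      ← integral_indicator hmeas]
    · congr 1
      ext s
      by_cases hs : s ∈ Icc (max (-(2 * K)) (t - r)) (min (-K) (t + r)) ∪ Icc (max K (t - r)) (min (2 * K) (t + r))
      · rw [indicator_of_mem hs, indicator_of_mem hs, smul_eq_mul]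
        simp [mul_comm ξ s]
      · rw [indicator_of_notMem hs, indicator_of_notMem hs, smul_zero]
    · rw [Set.disjoint_left]
      intro s h1 h2
      have := h1.2.trans (min_le_left _ _)
      have := (le_max_left _ _).trans h2.1
      linarith
  rw [hF]
  obtain ⟨h1, h2⟩ := hB r t (max (-(2 * K)) (t - r)) (min (-K) (t + r)) ξ hr (le_max_right _ _) (min_le_right _ _)
  obtain ⟨h3, h4⟩ := hB r t (max K (t - r)) (min (2 * K) (t + r)) ξ hr (le_max_right _ _) (min_le_right _ _)
  have l1 : max (min (-K) (t + r) - max (-(2 * K)) (t - r)) 0 ≤ 2 * min r K := by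
    rcases min_choice r K with h | h <;> rw [h] <;> refine max_le ?_ (by positivity)
    · linarith [min_le_right (-K) (t + r), le_max_right (-(2 * K)) (t - r)]
    · linarith [min_le_left (-K) (t + r), le_max_left (-(2 * K)) (t - r)]
  have l2 : max (min (2 * K) (t + r) - max K (t - r)) 0 ≤ 2 * min r K := by
    rcases min_choice r K with h | h <;> rw [h] <;> refine max_le ?_ (by positivity)
    · linarith [min_le_right (2 * K) (t + r), le_max_right K (t - r)]
    · linarith [min_le_left (2 * K) (t + r), le_max_left K (t - r)]
  constructor
  · refine (norm_add_le _ _).trans ?_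
    have := mul_le_mul_of_nonneg_left l1 hB0
    have := mul_le_mul_of_nonneg_left l2 hB0
    linarith
  · refine (mul_le_mul_of_nonneg_left (norm_add_le _ _) (abs_nonneg ξ)).trans ?_
    linarith

/-- The comparison profile. -/
def Gprof (γ : ℝ) (η : ℝ) : ℝ := if η ≤ 1 then η ^ (2 * γ) else η ^ (2 * γ - 2)

lemma Gprof_integrable (γ : ℝ) (h1 : -1 < 2 * γ) (h2 : 2 * γ < 1) :
    Integrable (fun η : ℝ => Gprof γ |η|) := by
  have hI : IntegrableOn (Gprof γ) (Ioi 0) := by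
    rw [← Ioc_union_Ioi_eq_Ioi (zero_le_one' ℝ)]
    refine IntegrableOn.union ?_ ?_
    · have h := (intervalIntegral.intervalIntegrable_rpow' (a := 0) (b := 1) h1).1
      refine h.congr_fun ?_ measurableSet_Ioc
      intro x hx
      simp [Gprof, hx.2]
    · have h := integrableOn_Ioi_rpow_of_lt (a := 2 * γ - 2) (by linarith) zero_lt_one
      refine h.congr_fun ?_ measurableSet_Ioi
      intro x hx
      simp [Gprof, not_le.mpr (mem_Ioi.mp hx)]
  have hp : IntegrableOn (fun η : ℝ => Gprof γ |η|) (Ioi 0) := by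
    refine hI.congr_fun ?_ measurableSet_Ioi
    intro x hx
    simp only [abs_of_pos (mem_Ioi.mp hx)]
  have hn : IntegrableOn (fun η : ℝ => Gprof γ |η|) (Iic 0) := by
    rw [← Measure.map_neg_eq_self (volume : Measure ℝ)]
    let m : MeasurableEmbedding fun x : ℝ => -x := (Homeomorph.neg ℝ).measurableEmbedding
    rw [m.integrableOn_map_iff]
    simp_rw [Function.comp_def, abs_neg, neg_preimage, neg_Iic, neg_zero]
    exact Iff.mpr integrableOn_Ici_iff_integrableOn_Ioi hp
  rw [← integrableOn_univ, ← Iic_union_Ioi (a := (0 : ℝ))]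
  exact hn.union hp

lemma Gprof_nonneg (γ η : ℝ) : 0 ≤ Gprof γ |η| := by
  unfold Gprof; split_ifs <;> positivity

/-- `Ḣ^{1-β}` bound for the truncated Legendre kernel
`h(s) = P_{(d-3)/2}((s-t)/r)` on `([-2^{k+1},-2^k] ∪ [2^k,2^{k+1}]) ∩ [t-r, t+r]`. -/
theorem stmt3 (d : ℕ) (hd : 3 ≤ d) (hodd : Odd d) (β : ℝ)
    (hβ : β ∈ Ioo (1 / 2 : ℝ) (3 / 2)) :
    ∃ C : ℝ, ∀ (k : ℤ) (r t : ℝ), 0 < r →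
      sobNorm (1 - β) ((Iset k ∩ Icc (t - r) (t + r)).indicator
          (fun s => ((legendreP ((d - 3) / 2) ((s - t) / r) : ℝ) : ℂ)))
        ≤ ENNReal.ofReal (C * (min r ((2 : ℝ) ^ k)) ^ (β - 1 / 2)) := by
  obtain ⟨A, hA0, hA⟩ := fourier_bound _ (legendre_contDiff ((d - 3) / 2))
  set γ : ℝ := 1 - β with hγ
  obtain ⟨hβ1, hβ2⟩ := hβ
  have hG := Gprof_integrable γ (by linarith) (by linarith)
  set J : ℝ := ∫ η : ℝ, Gprof γ |η| with hJ
  have hJ0 : 0 ≤ J := integral_nonneg (Gprof_nonneg γ)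
  refine ⟨A * J ^ (1 / 2 : ℝ), ?_⟩
  intro k r t hr
  have hbound := fun ξ => hA k r t ξ hr
  set L : ℝ := min r ((2:ℝ) ^ k) with hL
  have hL0 : 0 < L := lt_min hr (by positivity)
  set f := 𝓕 ((Iset k ∩ Icc (t - r) (t + r)).indicator
          (fun s => ((legendreP ((d - 3) / 2) ((s - t) / r) : ℝ) : ℂ))) with hf
  have hpt : ∀ ξ : ℝ, ENNReal.ofReal (|ξ| ^ (2 * γ)) * (‖f ξ‖₊ : ℝ≥0∞) ^ 2 ≤
      ENNReal.ofReal (A ^ 2 * L ^ (2 - 2 * γ) * Gprof γ |L * ξ|) := by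
    intro ξ
    obtain ⟨b1, b2⟩ := hbound ξ
    have e1 : (‖f ξ‖₊ : ℝ≥0∞) ^ 2 = ENNReal.ofReal (‖f ξ‖ ^ 2) := by
      rw [ENNReal.ofReal_pow (norm_nonneg _), ofReal_norm]; rfl
    rw [e1, ← ENNReal.ofReal_mul (by positivity)]
    apply ENNReal.ofReal_le_ofReal
    rw [abs_mul, abs_of_pos hL0]
    unfold Gprof
    split_ifs with h
    · rw [Real.mul_rpow hL0.le (abs_nonneg _)]
      have e2 : L ^ (2 - 2 * γ) * L ^ (2 * γ) = L ^ 2 := by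
        rw [← Real.rpow_add hL0, sub_add_cancel]; norm_num
      calc |ξ| ^ (2 * γ) * ‖f ξ‖ ^ 2 ≤ |ξ| ^ (2 * γ) * (A * L) ^ 2 := by gcongr
        _ = A ^ 2 * (L ^ (2 - 2 * γ) * L ^ (2 * γ)) * |ξ| ^ (2 * γ) := by rw [e2]; ring
        _ = _ := by ring
    · have hξ : 0 < |ξ| := by
        rcases (abs_nonneg ξ).eq_or_lt with h0 | h0
        · rw [← h0, mul_zero] at h; exact absurd zero_le_one h
        · exact h0
      rw [Real.mul_rpow hL0.le (abs_nonneg _)]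
      have e2 : L ^ (2 - 2 * γ) * L ^ (2 * γ - 2) = 1 := by
        rw [← Real.rpow_add hL0]; norm_num
      have e3 : |ξ| ^ (2 * γ) = |ξ| ^ (2 * γ - 2) * |ξ| ^ 2 := by
        rw [← Real.rpow_natCast, ← Real.rpow_add hξ]; norm_num
      calc |ξ| ^ (2 * γ) * ‖f ξ‖ ^ 2 = |ξ| ^ (2 * γ - 2) * (|ξ| * ‖f ξ‖) ^ 2 := by rw [e3]; ring
        _ ≤ |ξ| ^ (2 * γ - 2) * A ^ 2 := by gcongr
        _ = A ^ 2 * (L ^ (2 - 2 * γ) * L ^ (2 * γ - 2)) * |ξ| ^ (2 * γ - 2) := by rw [e2]; ring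
        _ = _ := by ring
  have hlint_eq : ∫⁻ ξ : ℝ, ENNReal.ofReal (A ^ 2 * L ^ (2 - 2 * γ) * Gprof γ |L * ξ|) =
      ENNReal.ofReal (A ^ 2 * L ^ (2 - 2 * γ) * (L⁻¹ * J)) := by
    rw [← ofReal_integral_eq_lintegral_ofReal]
    · rw [integral_const_mul, Measure.integral_comp_mul_left (fun η => Gprof γ |η|) L,
        abs_of_pos (inv_pos.mpr hL0), smul_eq_mul]
    · exact (hG.comp_mul_left' hL0.ne').const_mul _
    · exact Eventually.of_forall fun ξ => mul_nonneg (by positivity) (Gprof_nonneg _ _)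
  unfold sobNorm
  calc _ ≤ (ENNReal.ofReal (A ^ 2 * L ^ (2 - 2 * γ) * (L⁻¹ * J))) ^ ((1:ℝ) / 2) := by
        rw [← hlint_eq]
        gcongr with ξ
        exact hpt ξ
    _ = _ := by
        rw [ENNReal.ofReal_rpow_of_nonneg (by positivity) (by norm_num)]
        congr 1
        have e : A ^ 2 * L ^ (2 - 2 * γ) * (L⁻¹ * J) = A ^ 2 * (J * L ^ (2 * β - 1)) := by
          have : L ^ (2 - 2 * γ) * L⁻¹ = L ^ (2 * β - 1) := by
            rw [← Real.rpow_neg_one, ← Real.rpow_add hL0, hγ]; congr 1; ring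
          rw [← this]; ring
        rw [e, Real.mul_rpow (by positivity) (by positivity), Real.mul_rpow hJ0 (by positivity),
          ← Real.sqrt_eq_rpow, Real.sqrt_sq hA0, ← Real.rpow_mul hL0.le]
        rw [show (2 * β - 1) * (1 / 2) = β - 1 / 2 by ring, ← Real.sqrt_eq_rpow]
        ring
end
end

section
/- Let d ≥ 3 be an integer and let f : ℝ^d → ℝ be a radial function, f(x) = f₀(|x|), with f₀ continuous and compactly supported in (0, ∞). Then for all x ∈ ℝ^d and t with |x| > t > 0, ∫_{S^{d−1}} f(x + tω) dσ(ω) = (σ_{d−2} / (2^{d−3} (|x| t)^{d−2})) ∫_{|x|−t}^{|x|+t} r f₀(r) [((|x|+t)² − r²)(r² − (|x|−t)²)]^{(d−3)/2} dr, where σ_{d−2} is the (d−2)-dimensional surface measure of the unit sphere S^{d−2} ⊂ ℝ^{d−1} and dσ is the surface measure on S^{d−1} ⊂ ℝ^d. -/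
open MeasureTheory Real Set Filter Metric
open scoped FourierTransform ENNReal NNReal Topology

noncomputable section
noncomputable section

lemma polar_lint {E : Type*} [NormedAddCommGroup E] [NormedSpace ℝ E] [MeasurableSpace E]
    [BorelSpace E] [FiniteDimensional ℝ E] [Nontrivial E] (μ : Measure E) [μ.IsAddHaarMeasure]
    (F : E → ℝ≥0∞) (k : sphere (0 : E) 1 → ℝ≥0∞) (h : ℝ → ℝ≥0∞)
    (hk : Measurable k) (hh : Measurable h)
    (H : ∀ ω : sphere (0 : E) 1, ∀ r : ℝ, 0 < r → F (r • (ω : E)) = k ω * h r) :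
    ∫⁻ y, F y ∂μ = (∫⁻ ω, k ω ∂μ.toSphere) *
      ∫⁻ r in Ioi (0 : ℝ), ENNReal.ofReal (r ^ (Module.finrank ℝ E - 1)) * h r := by
  calc
    ∫⁻ y, F y ∂μ = ∫⁻ x : ({(0)}ᶜ : Set E), F x.1 ∂(μ.comap (↑)) := by
      rw [lintegral_subtype_comap (measurableSet_singleton _).compl F,
        restrict_compl_singleton]
    _ = ∫⁻ x, k x.1 * h x.2 ∂μ.toSphere.prod (.volumeIoiPow (Module.finrank ℝ E - 1)) := by
      rw [← μ.measurePreserving_homeomorphUnitSphereProd.lintegral_comp_emb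
        (Homeomorph.measurableEmbedding _)]
      refine lintegral_congr fun y => ?_
      have hy : (0:ℝ) < ‖(y : E)‖ := norm_pos_iff.2 y.2
      rw [← H _ _ ((homeomorphUnitSphereProd E y).2).2]
      congr 1
      simp [smul_smul, hy.ne']
    _ = (∫⁻ ω, k ω ∂μ.toSphere) *
          ∫⁻ x : Ioi (0 : ℝ), h x ∂.volumeIoiPow (Module.finrank ℝ E - 1) :=
      lintegral_prod_mul hk.aemeasurable (hh.comp measurable_subtype_coe).aemeasurable
    _ = _ := by
      rw [Measure.volumeIoiPow, lintegral_withDensity_eq_lintegral_mul]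
      · simp only [Pi.mul_apply]
        rw [lintegral_subtype_comap measurableSet_Ioi
          (fun a : ℝ => ENNReal.ofReal (a ^ (Module.finrank ℝ E - 1)) * h a)]
      · fun_prop
      · fun_prop

lemma slice_lint (m : ℕ) (F : ℝ → ℝ → ℝ≥0∞) (hF : Measurable (Function.uncurry F))
    (e : EuclideanSpace ℝ (Fin (m + 1))) (he : ‖e‖ = 1) :
    ∫⁻ y : EuclideanSpace ℝ (Fin (m + 1)), F (inner ℝ e y) ‖y‖ =
      ∫⁻ a : ℝ, ∫⁻ z : EuclideanSpace ℝ (Fin m), F a √(a ^ 2 + ‖z‖ ^ 2) := by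
  obtain ⟨b, hb⟩ := Orthonormal.exists_orthonormalBasis_extension_of_card_eq (𝕜 := ℝ)
    (E := EuclideanSpace ℝ (Fin (m + 1))) (ι := Fin (m + 1)) (by simp) (v := fun _ => e)
    (s := {0}) (by
      refine ⟨fun i => by simpa using he, fun i j hij => (hij (Subsingleton.elim _ _)).elim⟩)
  have hb0 : b 0 = e := hb 0 rfl
  rw [← b.repr.symm.measurePreserving.lintegral_comp_emb
    b.repr.symm.toHomeomorph.measurableEmbedding]
  have h1 : ∀ y, F (inner ℝ e (b.repr.symm y)) ‖b.repr.symm y‖ = F (y 0) ‖y‖ := by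
    intro y
    rw [LinearIsometryEquiv.norm_map, ← hb0, ← b.repr_apply_apply]
    simp
  simp_rw [h1]
  rw [← (EuclideanSpace.volume_preserving_symm_measurableEquiv_toLp (Fin (m + 1))).symm.lintegral_comp_emb
    (MeasurableEquiv.measurableEmbedding _)]
  rw [← (volume_preserving_piFinSuccAbove (fun _ : Fin (m + 1) => ℝ) 0).symm.lintegral_comp_emb
    (MeasurableEquiv.measurableEmbedding _)]
  have h2 : ∀ z : EuclideanSpace ℝ (Fin m), ∀ a : ℝ, F a √(a ^ 2 + ‖z‖ ^ 2) =
     F a √(a ^ 2 + ∑ i, z i ^ 2) := by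
    intro z a
    rw [EuclideanSpace.real_norm_sq_eq]
  simp_rw [h2]
  have h3 : ∀ a : ℝ, ∫⁻ z : EuclideanSpace ℝ (Fin m), F a √(a ^ 2 + ∑ i, z i ^ 2) =
     ∫⁻ z : Fin m → ℝ, F a √(a ^ 2 + ∑ i, z i ^ 2) := by
    intro a
    rw [← (EuclideanSpace.volume_preserving_symm_measurableEquiv_toLp (Fin m)).symm.lintegral_comp_emb
      (MeasurableEquiv.measurableEmbedding _)]
    rfl
  simp_rw [h3]
  rw [← lintegral_prod (fun p : ℝ × (Fin m → ℝ) => F p.1 √(p.1 ^ 2 + ∑ i, p.2 i ^ 2))]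
  · refine lintegral_congr fun p => ?_
    simp [EuclideanSpace.norm_eq, Fin.sum_univ_succ, MeasurableEquiv.piFinSuccAbove]
  · exact (hF.comp (f := fun p : ℝ × (Fin m → ℝ) => (p.1, √(p.1 ^ 2 + ∑ i, p.2 i ^ 2))) (by fun_prop)).aemeasurable

lemma half_plane (n : ℕ) (g h : ℝ → ℝ≥0∞) (hg : Measurable g) (hh : Measurable h) :
    ∫⁻ a : ℝ, ∫⁻ ρ in Ioi (0 : ℝ), ENNReal.ofReal (ρ ^ n) *
        (g (a / √(a ^ 2 + ρ ^ 2)) * h √(a ^ 2 + ρ ^ 2)) =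
      (∫⁻ θ in Ioo 0 π, ENNReal.ofReal (sin θ ^ n) * g (cos θ)) *
        ∫⁻ r in Ioi (0 : ℝ), ENNReal.ofReal (r ^ (n + 1)) * h r := by
  simp_rw [← lintegral_indicator measurableSet_Ioi]
  rw [lintegral_indicator measurableSet_Ioi (fun r => ENNReal.ofReal (r ^ (n + 1)) * h r)]
  let K : ℝ × ℝ → ℝ≥0∞ := fun p => (Ioi (0:ℝ)).indicator (fun ρ => ENNReal.ofReal (ρ ^ n) *
        (g (p.1 / √(p.1 ^ 2 + ρ ^ 2)) * h √(p.1 ^ 2 + ρ ^ 2))) p.2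
  have hK : K = (Prod.snd ⁻¹' (Ioi (0:ℝ))).indicator (fun p : ℝ × ℝ => ENNReal.ofReal (p.2 ^ n) *
        (g (p.1 / √(p.1 ^ 2 + p.2 ^ 2)) * h √(p.1 ^ 2 + p.2 ^ 2))) := by
    ext p
    by_cases hp : 0 < p.2 <;> simp [K, indicator, hp]
  have hKm : Measurable K := by
    rw [hK]
    exact Measurable.indicator (by fun_prop) (measurable_snd measurableSet_Ioi)
  rw [← lintegral_prod K hKm.aemeasurable]
  change ∫⁻ p : ℝ × ℝ, K p = _
  rw [← lintegral_comp_polarCoord_symm K]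
  have h1 : ∀ p ∈ polarCoord.target, ENNReal.ofReal p.1 • K (polarCoord.symm p) =
      (ENNReal.ofReal (p.1 ^ (n + 1)) * h p.1) *
       (Ioo 0 π).indicator (fun θ => ENNReal.ofReal (sin θ ^ n) * g (cos θ)) p.2 := by
    rintro ⟨r, θ⟩ ⟨hr, hθ⟩
    simp only [mem_Ioi, mem_Ioo] at hr hθ
    simp only [polarCoord_symm_apply, K, smul_eq_mul]
    by_cases h0 : 0 < θ
    · have hs : 0 < sin θ := sin_pos_of_pos_of_lt_pi h0 hθ.2
      have e1 : √((r * cos θ) ^ 2 + (r * sin θ) ^ 2) = r := by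
        rw [show (r * cos θ) ^ 2 + (r * sin θ) ^ 2 = r ^ 2 by
          linear_combination r ^ 2 * sin_sq_add_cos_sq θ]
        exact sqrt_sq hr.le
      rw [indicator_of_mem (show r * sin θ ∈ Ioi 0 from mul_pos hr hs),
        indicator_of_mem (show θ ∈ Ioo 0 π from ⟨h0, hθ.2⟩), e1, mul_div_cancel_left₀ _ hr.ne',
        mul_pow, pow_succ, ENNReal.ofReal_mul (by positivity), ENNReal.ofReal_mul (by positivity)]
      ring
    · have hs : sin θ ≤ 0 := sin_nonpos_of_nonpos_of_neg_pi_le (not_lt.1 h0) hθ.1.le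
      rw [indicator_of_notMem, indicator_of_notMem]
      · simp
      · simp [h0]
      · simpa using mul_nonpos_of_nonneg_of_nonpos hr.le hs
  rw [setLIntegral_congr_fun polarCoord.open_target.measurableSet h1, polarCoord_target,
    Measure.volume_eq_prod, ← Measure.prod_restrict,
    lintegral_prod_mul (f := fun r => ENNReal.ofReal (r ^ (n + 1)) * h r)
      (g := (Ioo 0 π).indicator (fun θ => ENNReal.ofReal (sin θ ^ n) * g (cos θ))), mul_comm,
    lintegral_indicator measurableSet_Ioo, Measure.restrict_restrict measurableSet_Ioo]
  · have hI : Ioo 0 π ∩ Ioo (-π) π = Ioo 0 π :=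
      inter_eq_left.2 (Ioo_subset_Ioo_left (by linarith [pi_pos]))
    rw [hI]
  · fun_prop
  · exact (Measurable.indicator (by fun_prop) measurableSet_Ioo).aemeasurable

lemma key_lint (n : ℕ) (e : EuclideanSpace ℝ (Fin (n + 2))) (he : ‖e‖ = 1) (g : ℝ → ℝ≥0∞)
    (hg : Measurable g) :
    ∫⁻ ω : sphere (0 : EuclideanSpace ℝ (Fin (n + 2))) 1, g (inner ℝ e (ω : EuclideanSpace ℝ (Fin (n + 2))))
      ∂(volume : Measure (EuclideanSpace ℝ (Fin (n + 2)))).toSphere =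
    (volume : Measure (EuclideanSpace ℝ (Fin (n + 1)))).toSphere univ *
      ∫⁻ θ in Ioo 0 π, ENNReal.ofReal (sin θ ^ n) * g (cos θ) := by
  let h : ℝ → ℝ≥0∞ := fun r => ENNReal.ofReal (exp (-r))
  have hh : Measurable h := by fun_prop
  set C := ∫⁻ r in Ioi (0 : ℝ), ENNReal.ofReal (r ^ (n + 1)) * h r with hC
  have hCv : C = ENNReal.ofReal (Gamma (n + 2)) := by
    have hint := Real.GammaIntegral_convergent (s := n + 2) (by positivity)
    rw [Real.Gamma_eq_integral (by positivity), ofReal_integral_eq_lintegral_ofReal hint]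
    · refine setLIntegral_congr_fun measurableSet_Ioi fun r hr => ?_
      have hr : 0 < r := hr
      simp only [h]
      rw [← ENNReal.ofReal_mul (by positivity), mul_comm,
        show (n + 2 - 1 : ℝ) = ((n + 1 : ℕ) : ℝ) by push_cast; ring, rpow_natCast]
    · filter_upwards [self_mem_ae_restrict measurableSet_Ioi] with r hr
      have hr : 0 < r := hr
      simp only [Pi.zero_apply]; positivity
  have hC0 : C ≠ 0 := by
    rw [hCv]
    exact (ENNReal.ofReal_pos.2 (Gamma_pos_of_pos (by positivity))).ne'
  have hCt : C ≠ ∞ := by rw [hCv]; exact ENNReal.ofReal_ne_top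
  have h1 := polar_lint (volume : Measure (EuclideanSpace ℝ (Fin (n + 2))))
    (fun y => g (inner ℝ e y / ‖y‖) * h ‖y‖) (fun ω => g (inner ℝ e (ω : EuclideanSpace ℝ (Fin (n + 2))))) h
    (by fun_prop) hh (by
      intro ω r hr
      have : ‖(ω : EuclideanSpace ℝ (Fin (n + 2)))‖ = 1 := by simp
      simp only [norm_smul, this, inner_smul_right, Real.norm_eq_abs, abs_of_pos hr, mul_one]
      rw [mul_div_cancel_left₀ _ hr.ne'])
  have h2 := slice_lint (n + 1) (fun a R => g (a / R) * h R) (by unfold Function.uncurry; fun_prop) e he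
  have h3 : ∀ a : ℝ, ∫⁻ z : EuclideanSpace ℝ (Fin (n + 1)),
      g (a / √(a ^ 2 + ‖z‖ ^ 2)) * h √(a ^ 2 + ‖z‖ ^ 2) =
      (volume : Measure (EuclideanSpace ℝ (Fin (n + 1)))).toSphere univ *
      ∫⁻ ρ in Ioi (0 : ℝ), ENNReal.ofReal (ρ ^ n) *
        (g (a / √(a ^ 2 + ρ ^ 2)) * h √(a ^ 2 + ρ ^ 2)) := by
    intro a
    have := polar_lint (volume : Measure (EuclideanSpace ℝ (Fin (n + 1))))
      (fun z => g (a / √(a ^ 2 + ‖z‖ ^ 2)) * h √(a ^ 2 + ‖z‖ ^ 2)) (fun _ => 1)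
      (fun ρ => g (a / √(a ^ 2 + ρ ^ 2)) * h √(a ^ 2 + ρ ^ 2)) (by fun_prop) (by fun_prop) (by
        intro ω r hr
        have : ‖(ω : EuclideanSpace ℝ (Fin (n + 1)))‖ = 1 := by simp
        simp only [norm_smul, this, Real.norm_eq_abs, abs_of_pos hr, mul_one, one_mul])
    rw [this]
    simp only [lintegral_one, finrank_euclideanSpace, Fintype.card_fin, Nat.add_sub_cancel]
  simp_rw [h3] at h2
  rw [lintegral_const_mul' _ _ (measure_ne_top _ _), half_plane n g h hg hh, h1] at h2
  simp only [finrank_euclideanSpace, Fintype.card_fin] at h2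
  rw [show n + 2 - 1 = n + 1 from rfl, ← hC, ← mul_assoc] at h2
  exact (ENNReal.mul_left_inj hC0 hCt).1 h2

lemma key_int (n : ℕ) (e : EuclideanSpace ℝ (Fin (n + 2))) (he : ‖e‖ = 1) (g : ℝ → ℝ)
    (hg : Continuous g) :
    ∫ ω : sphere (0 : EuclideanSpace ℝ (Fin (n + 2))) 1, g (inner ℝ e (ω : EuclideanSpace ℝ (Fin (n + 2))))
      ∂(volume : Measure (EuclideanSpace ℝ (Fin (n + 2)))).toSphere =
    ((volume : Measure (EuclideanSpace ℝ (Fin (n + 1)))).toSphere univ).toReal *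
      ∫ θ in 0..π, sin θ ^ n * g (cos θ) := by
  have hm : Measurable (fun θ : ℝ => Real.toNNReal (sin θ ^ n)) := by fun_prop
  have hmeas : Measure.map (fun ω : sphere (0 : EuclideanSpace ℝ (Fin (n + 2))) 1 =>
        inner ℝ e (ω : EuclideanSpace ℝ (Fin (n + 2))))
        (volume : Measure (EuclideanSpace ℝ (Fin (n + 2)))).toSphere =
      (volume : Measure (EuclideanSpace ℝ (Fin (n + 1)))).toSphere univ •
       Measure.map cos ((volume.restrict (Ioo 0 π)).withDensity
        (fun θ => (Real.toNNReal (sin θ ^ n) : ℝ≥0∞))) := by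
    ext s hs
    have := key_lint n e he (s.indicator 1) (measurable_one.indicator hs)
    rw [← lintegral_indicator_one hs, lintegral_map (measurable_one.indicator hs) (by fun_prop),
      this, Measure.smul_apply, smul_eq_mul, ← lintegral_indicator_one hs,
      lintegral_map (measurable_one.indicator hs) (by fun_prop),
      lintegral_withDensity_eq_lintegral_mul (volume.restrict (Ioo 0 π))
        (f := fun θ => (Real.toNNReal (sin θ ^ n) : ℝ≥0∞)) (by fun_prop)
        (g := fun θ => s.indicator 1 (cos θ))
        ((measurable_one.indicator hs).comp measurable_cos)]
    rfl
  rw [← integral_map (φ := fun ω : sphere (0 : EuclideanSpace ℝ (Fin (n + 2))) 1 =>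
        inner ℝ e (ω : EuclideanSpace ℝ (Fin (n + 2)))) (f := g) (by fun_prop)
        hg.aestronglyMeasurable, hmeas, integral_smul_measure,
      integral_map (by fun_prop) hg.aestronglyMeasurable,
      integral_withDensity_eq_integral_smul hm, smul_eq_mul,
      intervalIntegral.integral_of_le pi_pos.le, integral_Ioc_eq_integral_Ioo]
  congr 1
  refine setIntegral_congr_fun measurableSet_Ioo fun θ hθ => ?_
  have : 0 < sin θ := sin_pos_of_mem_Ioo hθ
  simp only [NNReal.smul_def, smul_eq_mul]
  rw [Real.coe_toNNReal _ (by positivity)]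

lemma subst_int (n : ℕ) (hn : 1 ≤ n) (f₀ : ℝ → ℝ) (hf : Continuous f₀) (X t : ℝ) (ht : 0 < t)
    (hX : t < X) :
    ∫ θ in 0..π, sin θ ^ n * f₀ √(X ^ 2 + t ^ 2 + 2 * X * t * cos θ) =
      1 / (2 ^ (n - 1) * (X * t) ^ n) * ∫ r in (X - t)..(X + t), r * f₀ r *
        (((X + t) ^ 2 - r ^ 2) * (r ^ 2 - (X - t) ^ 2)) ^ (((n : ℝ) - 1) / 2) := by
  have hX0 : 0 < X := ht.trans hX
  have hn1 : (1:ℝ) ≤ n := by exact_mod_cast hn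
  set R : ℝ → ℝ := fun θ => √(X ^ 2 + t ^ 2 + 2 * X * t * cos θ) with hR
  have hpos : ∀ θ, 0 < X ^ 2 + t ^ 2 + 2 * X * t * cos θ := by
    intro θ
    have := neg_one_le_cos θ
    nlinarith [mul_pos hX0 ht, mul_pos (sub_pos.2 hX) (sub_pos.2 hX)]
  have hRpos : ∀ θ, 0 < R θ := fun θ => sqrt_pos.2 (hpos θ)
  have hRsq : ∀ θ, R θ ^ 2 = X ^ 2 + t ^ 2 + 2 * X * t * cos θ := fun θ => sq_sqrt (hpos θ).le
  have hRc : Continuous R := by fun_prop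
  have hd : ∀ θ, HasDerivAt R (-(X * t * sin θ) / R θ) θ := by
    intro θ
    have := (((hasDerivAt_cos θ).const_mul (2 * X * t)).const_add (X ^ 2 + t ^ 2)).sqrt (hpos θ).ne'
    convert this using 1
    simp only [hR]
    have := (hRpos θ).ne'
    field_simp
  let G : ℝ → ℝ := fun r => r * f₀ r *
        (((X + t) ^ 2 - r ^ 2) * (r ^ 2 - (X - t) ^ 2)) ^ (((n : ℝ) - 1) / 2)
  have hG : Continuous G := by
    refine (continuous_id.mul hf).mul (Continuous.rpow_const (by fun_prop) fun _ => Or.inr ?_)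
    linarith
  have key := intervalIntegral.integral_comp_mul_deriv (a := 0) (b := π) (f := R)
    (f' := fun θ => -(X * t * sin θ) / R θ) (g := G) (fun θ _ => hd θ)
    (Continuous.continuousOn (by
      exact Continuous.div (by fun_prop) hRc fun θ => (hRpos θ).ne')) hG
  have R0 : R 0 = X + t := by
    simp only [hR, cos_zero]
    rw [show X ^ 2 + t ^ 2 + 2 * X * t * 1 = (X + t) ^ 2 by ring, sqrt_sq (by positivity)]
  have Rpi : R π = X - t := by
    simp only [hR, cos_pi]
    rw [show X ^ 2 + t ^ 2 + 2 * X * t * (-1) = (X - t) ^ 2 by ring, sqrt_sq (by linarith)]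
  rw [R0, Rpi, intervalIntegral.integral_symm (X - t)] at key
  have key' : ∫ r in (X - t)..(X + t), G r =
      - ∫ θ in 0..π, (G ∘ R) θ * (-(X * t * sin θ) / R θ) := by rw [key, neg_neg]
  change _ = 1 / (2 ^ (n - 1) * (X * t) ^ n) * ∫ r in (X - t)..(X + t), G r
  rw [key', ← intervalIntegral.integral_neg, ← intervalIntegral.integral_const_mul]
  refine intervalIntegral.integral_congr fun θ hθ => ?_
  rw [uIcc_of_le pi_pos.le] at hθ
  have hs : 0 ≤ sin θ := sin_nonneg_of_mem_Icc hθ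
  have e1 : ((X + t) ^ 2 - R θ ^ 2) * (R θ ^ 2 - (X - t) ^ 2) = (2 * (X * t) * sin θ) ^ 2 := by
    rw [hRsq]
    linear_combination (-4 * X ^ 2 * t ^ 2) * sin_sq_add_cos_sq θ
  have e2 : ((2 * (X * t) * sin θ) ^ 2) ^ (((n : ℝ) - 1) / 2) = (2 * (X * t) * sin θ) ^ (n - 1) := by
    rw [← rpow_natCast _ 2, ← rpow_mul (by positivity), ← rpow_natCast _ (n - 1)]
    congr 1
    push_cast [hn]
    ring
  simp only [G, Function.comp]
  rw [e1, e2]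
  obtain ⟨k, rfl⟩ : ∃ k, n = k + 1 := ⟨n - 1, by omega⟩
  have := (hRpos θ).ne'
  change sin θ ^ (k + 1) * f₀ (R θ) = _
  simp only [Nat.add_sub_cancel, mul_pow, pow_succ]
  field_simp

/-- Explicit formula for the spherical mean of a radial function:
for `|x| > t > 0`,
`∫_{S^{d-1}} f(x+tω) dσ(ω) = (σ_{d-2}/(2^{d-3}(|x|t)^{d-2})) ∫_{|x|-t}^{|x|+t} r f₀(r)
[((|x|+t)²-r²)(r²-(|x|-t)²)]^{(d-3)/2} dr`. -/
theorem stmt14 (d : ℕ) (hd : 3 ≤ d) (f₀ : ℝ → ℝ) (hcont : Continuous f₀)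
    (hcs : HasCompactSupport f₀) (hpos : tsupport f₀ ⊆ Ioi 0)
    (f : EuclideanSpace ℝ (Fin d) → ℝ) (hf : ∀ x, f x = f₀ ‖x‖)
    (x : EuclideanSpace ℝ (Fin d)) (t : ℝ) (ht : 0 < t) (hxt : t < ‖x‖) :
    (∫ ω : sphere (0 : EuclideanSpace ℝ (Fin d)) 1,
        f (x + t • (ω : EuclideanSpace ℝ (Fin d)))
          ∂((volume : Measure (EuclideanSpace ℝ (Fin d))).toSphere)) =
      (((volume : Measure (EuclideanSpace ℝ (Fin (d - 1)))).toSphere univ).toReal /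
          ((2 : ℝ) ^ (d - 3) * (‖x‖ * t) ^ (d - 2))) *
        ∫ r in (‖x‖ - t)..(‖x‖ + t),
          r * f₀ r *
            ((((‖x‖ + t) ^ 2 - r ^ 2) * (r ^ 2 - (‖x‖ - t) ^ 2)) ^ (((d : ℝ) - 3) / 2)) := by
  obtain ⟨n, rfl⟩ : ∃ n, d = n + 2 := ⟨d - 2, by omega⟩
  have hX : 0 < ‖x‖ := ht.trans hxt
  have h1 : ∀ ω : sphere (0 : EuclideanSpace ℝ (Fin (n + 2))) 1,
      f (x + t • (ω : EuclideanSpace ℝ (Fin (n + 2)))) =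
      f₀ √(‖x‖ ^ 2 + t ^ 2 + 2 * ‖x‖ * t *
        inner ℝ (‖x‖⁻¹ • x) (ω : EuclideanSpace ℝ (Fin (n + 2)))) := by
    intro ω
    have hω : ‖(ω : EuclideanSpace ℝ (Fin (n + 2)))‖ = 1 := by simp
    rw [hf]
    congr 1
    rw [← sqrt_sq (norm_nonneg (x + t • (ω : EuclideanSpace ℝ (Fin (n + 2)))))]
    congr 1
    rw [norm_add_sq_real, norm_smul, hω, inner_smul_right, real_inner_smul_left, Real.norm_eq_abs,
      abs_of_pos ht]
    field_simp
    ring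
  simp_rw [h1]
  rw [key_int n (‖x‖⁻¹ • x) (by rw [norm_smul, norm_inv, norm_norm, inv_mul_cancel₀ hX.ne'])
    (fun s => f₀ √(‖x‖ ^ 2 + t ^ 2 + 2 * ‖x‖ * t * s)) (by fun_prop),
    subst_int n (by omega) f₀ hcont ‖x‖ t ht hxt, ← mul_assoc, mul_one_div]
  have e : (((n + 2 : ℕ) : ℝ) - 3) / 2 = ((n : ℝ) - 1) / 2 := by push_cast; ring
  rw [e]
  rfl
end
end
end

section
/- Let d ≥ 3 be an odd integer, μ = (d−1)/2, and let G : ℝ → ℝ be of class C^{μ−1}. Then for every r > 0 and t ∈ ℝ, (2π)^{−μ} ∫_{S^{d−1}} G^{(μ−1)}(r ω₁ + t) dσ(ω) = r^{−(d−1)/2} ∫_{t−r}^{t+r} G(s) P_{(d−3)/2}((s−t)/r) ds, where ω₁ denotes the first coordinate of ω ∈ S^{d−1} and G^{(μ−1)} is the (μ−1)-th derivative of G. -/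
open MeasureTheory Real Set Filter Metric
open scoped FourierTransform ENNReal NNReal Topology

noncomputable section
noncomputable section

/-- Radial Gaussian moment. -/
lemma aux_radial (k : ℕ) :
    ∫ x in Ioi (0 : ℝ), x ^ k * exp (-x ^ 2) = Gamma (((k : ℝ) + 1) / 2) / 2 := by
  have h := integral_rpow_mul_exp_neg_rpow (p := 2) (q := k) two_pos
    (by have : (0 : ℝ) ≤ k := Nat.cast_nonneg k
        linarith)
  rw [show Gamma (((k : ℝ) + 1) / 2) / 2 = 1 / 2 * Gamma (((k : ℝ) + 1) / 2) by ring, ← h]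
  refine setIntegral_congr_fun measurableSet_Ioi fun x hx => ?_
  simp only [rpow_natCast]
  norm_num

lemma aux_gauss_even (j : ℕ) :
    ∫ x : ℝ, x ^ (2 * j) * exp (-x ^ 2) = Gamma ((j : ℝ) + 1 / 2) := by
  have h := integral_comp_abs (f := fun x : ℝ => x ^ (2 * j) * exp (-x ^ 2))
  rw [aux_radial] at h
  simp only [pow_mul, sq_abs] at h
  simp only [pow_mul]
  rw [h]
  push_cast
  rw [show ((2 : ℝ) * j + 1) / 2 = j + 1 / 2 by ring]
  ring

lemma aux_gauss_odd (j : ℕ) :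
    ∫ x : ℝ, x ^ (2 * j + 1) * exp (-x ^ 2) = 0 := by
  have h := integral_neg_eq_self (fun x : ℝ => x ^ (2 * j + 1) * exp (-x ^ 2)) volume
  have h2 : ∀ x : ℝ, (-x) ^ (2 * j + 1) * exp (-(-x) ^ 2) = -(x ^ (2 * j + 1) * exp (-x ^ 2)) := by
    intro x
    rw [Odd.neg_pow (by simp), neg_sq]; ring
  simp only [h2, integral_neg] at h
  linarith

lemma aux_prod (d : ℕ) (i : Fin d) (k : ℕ) :
    ∫ x : EuclideanSpace ℝ (Fin d), (x i) ^ k * exp (-‖x‖ ^ 2) =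
      (∫ x : ℝ, x ^ k * exp (-x ^ 2)) * (√π) ^ (d - 1) := by
  rw [← (PiLp.volume_preserving_toLp (Fin d)).integral_comp
    (MeasurableEquiv.toLp 2 (Fin d → ℝ)).measurableEmbedding]
  have h : ∀ x : Fin d → ℝ, (WithLp.toLp 2 x : EuclideanSpace ℝ (Fin d)) i ^ k *
      exp (-‖(WithLp.toLp 2 x : EuclideanSpace ℝ (Fin d))‖ ^ 2) =
      ∏ l, (if l = i then (x l) ^ k else 1) * exp (-(x l) ^ 2) := by
    intro x
    rw [Finset.prod_mul_distrib, Finset.prod_ite_eq' Finset.univ i, EuclideanSpace.norm_sq_eq,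
      ← exp_sum]
    simp
  simp only [h]
  rw [integral_fintype_prod_volume_eq_prod
    (fun l (y : ℝ) => (if l = i then y ^ k else 1) * exp (-y ^ 2)),
    ← Finset.mul_prod_erase Finset.univ _ (Finset.mem_univ i)]
  congr 1
  · simp
  · rw [Finset.prod_congr rfl (g := fun _ => √π)]
    · simp
    · intro l hl
      have := integral_gaussian 1
      simp only [Finset.ne_of_mem_erase hl, if_false, one_mul]
      simpa using this

lemma aux_polar (d : ℕ) (hd : 1 ≤ d) (i : Fin d) (k : ℕ) :
    ∫ x : EuclideanSpace ℝ (Fin d), (x i) ^ k * exp (-‖x‖ ^ 2) =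
      (∫ ω : sphere (0 : EuclideanSpace ℝ (Fin d)) 1, ((ω : EuclideanSpace ℝ (Fin d)) i) ^ k
        ∂((volume : Measure (EuclideanSpace ℝ (Fin d))).toSphere)) *
      (Gamma (((k : ℝ) + d) / 2) / 2) := by
  have hdim : Module.finrank ℝ (EuclideanSpace ℝ (Fin d)) = d := finrank_euclideanSpace_fin
  calc
    _ = ∫ x : ({(0)}ᶜ : Set (EuclideanSpace ℝ (Fin d))), (x.1 i) ^ k * exp (-‖x.1‖ ^ 2) ∂(volume.comap Subtype.val) := by
      have : Nonempty (Fin d) := ⟨i⟩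
      rw [integral_subtype_comap (measurableSet_singleton _).compl
        fun x : (EuclideanSpace ℝ (Fin d)) ↦ (x i) ^ k * exp (-‖x‖ ^ 2), restrict_compl_singleton]
    _ = ∫ x, (x.1.1 i) ^ k * ((x.2.1) ^ k * exp (-x.2.1 ^ 2))
          ∂(volume : Measure (EuclideanSpace ℝ (Fin d))).toSphere.prod (.volumeIoiPow (Module.finrank ℝ (EuclideanSpace ℝ (Fin d)) - 1)) := by
      rw [← (volume : Measure (EuclideanSpace ℝ (Fin d))).measurePreserving_homeomorphUnitSphereProd.integral_comp
        (Homeomorph.measurableEmbedding _)]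
      refine integral_congr_ae (Eventually.of_forall fun x => ?_)
      have hx : ‖x.1‖ ≠ 0 := norm_ne_zero_iff.2 x.2
      simp only [homeomorphUnitSphereProd_apply_fst_coe, homeomorphUnitSphereProd_apply_snd_coe,
        PiLp.smul_apply, smul_eq_mul]
      rw [← mul_assoc, ← mul_pow]
      congr 2
      field_simp
    _ = _ := by
      rw [integral_prod_mul (fun ω : sphere (0 : (EuclideanSpace ℝ (Fin d))) 1 => (ω.1 i) ^ k)
        (fun x : Ioi (0 : ℝ) => x.1 ^ k * exp (-x.1 ^ 2))]
      congr 1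
      simp only [Measure.volumeIoiPow, ENNReal.ofReal]
      rw [integral_withDensity_eq_integral_smul,
        integral_subtype_comap measurableSet_Ioi fun a ↦
          Real.toNNReal (a ^ (Module.finrank ℝ (EuclideanSpace ℝ (Fin d)) - 1)) • (a ^ k * exp (-a ^ 2)),
        setIntegral_congr_fun (g := fun x : ℝ => x ^ (k + (d - 1)) * exp (-x ^ 2))
          measurableSet_Ioi fun x hx ↦ ?_, aux_radial]
      · congr 3
        push_cast [hd]
        ring
      · simp only [NNReal.smul_def, Real.coe_toNNReal _ (pow_nonneg (le_of_lt hx) _), hdim,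
          smul_eq_mul]
        ring
      · exact (measurable_subtype_coe.pow_const _).real_toNNReal

lemma aux_beta (m : ℕ) : ∀ j : ℕ, ∫ u in (-1 : ℝ)..1, u ^ (2 * j) * (1 - u ^ 2) ^ m =
    Gamma ((j : ℝ) + 1 / 2) * (m.factorial : ℝ) / Gamma ((j : ℝ) + m + 3 / 2) := by
  induction m with
  | zero =>
    intro j
    have hj : (0 : ℝ) < (j : ℝ) + 1 / 2 := by positivity
    have hg := Gamma_pos_of_pos hj
    simp only [pow_zero, mul_one, integral_pow, Nat.factorial_zero, Nat.cast_one, Nat.cast_zero,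
      add_zero]
    rw [show (j : ℝ) + 3 / 2 = (j + 1 / 2) + 1 by ring, Gamma_add_one hj.ne',
      Odd.neg_one_pow (by simp)]
    push_cast
    field_simp
    ring
  | succ m ih =>
    intro j
    have h : ∀ u : ℝ, u ^ (2 * j) * (1 - u ^ 2) ^ (m + 1) =
        u ^ (2 * j) * (1 - u ^ 2) ^ m - u ^ (2 * (j + 1)) * (1 - u ^ 2) ^ m := by
      intro u; ring
    simp only [h]
    rw [intervalIntegral.integral_sub (Continuous.intervalIntegrable (by fun_prop) _ _)
      (Continuous.intervalIntegrable (by fun_prop) _ _), ih, ih]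
    have hj : (0 : ℝ) < (j : ℝ) + 1 / 2 := by positivity
    have hm : (0 : ℝ) < (j : ℝ) + m + 3 / 2 := by positivity
    have hg := Gamma_pos_of_pos hj
    have hg2 := Gamma_pos_of_pos hm
    push_cast [Nat.factorial_succ]
    rw [show (j : ℝ) + 1 + 1 / 2 = (j + 1 / 2) + 1 by ring, Gamma_add_one hj.ne',
      show (j : ℝ) + 1 + m + 3 / 2 = (j + m + 3 / 2) + 1 by ring,
      show (j : ℝ) + (m + 1) + 3 / 2 = (j + m + 3 / 2) + 1 by ring, Gamma_add_one hm.ne']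
    field_simp
    ring

lemma aux_beta_odd (m j : ℕ) :
    ∫ u in (-1 : ℝ)..1, u ^ (2 * j + 1) * (1 - u ^ 2) ^ m = 0 := by
  have h := intervalIntegral.integral_comp_neg (a := -1) (b := 1)
    (fun u : ℝ => u ^ (2 * j + 1) * (1 - u ^ 2) ^ m)
  have h2 : ∀ u : ℝ, (-u) ^ (2 * j + 1) * (1 - (-u) ^ 2) ^ m =
      -(u ^ (2 * j + 1) * (1 - u ^ 2) ^ m) := by
    intro x
    rw [Odd.neg_pow (by simp), neg_sq]; ring
  simp only [h2, intervalIntegral.integral_neg, neg_neg] at h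
  linarith

lemma aux_moment (m k : ℕ) (i : Fin (2 * m + 3)) :
    ∫ ω : sphere (0 : EuclideanSpace ℝ (Fin (2 * m + 3))) 1,
      ((ω : EuclideanSpace ℝ (Fin (2 * m + 3))) i) ^ k
        ∂((volume : Measure (EuclideanSpace ℝ (Fin (2 * m + 3)))).toSphere) =
    2 * π ^ (m + 1) / m.factorial * ∫ u in (-1 : ℝ)..1, u ^ k * (1 - u ^ 2) ^ m := by
  have h := aux_polar (2 * m + 3) (by omega) i k
  rw [aux_prod] at h
  have hsq : (√π) ^ (2 * m + 3 - 1) = π ^ (m + 1) := by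
    rw [show 2 * m + 3 - 1 = 2 * (m + 1) by omega, pow_mul, sq_sqrt pi_pos.le]
  rw [hsq] at h
  have hpos : (0 : ℝ) < ((k : ℝ) + (2 * m + 3 : ℕ)) / 2 := by positivity
  have hg := Gamma_pos_of_pos hpos
  have hfac : (m.factorial : ℝ) ≠ 0 := by positivity
  rcases Nat.even_or_odd' k with ⟨j, rfl | rfl⟩
  · rw [aux_gauss_even] at h
    rw [aux_beta]
    have e : (((2 * j : ℕ) : ℝ) + (2 * m + 3 : ℕ)) / 2 = (j : ℝ) + m + 3 / 2 := by
      push_cast; ring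
    rw [e] at h hg
    generalize Gamma ((j : ℝ) + m + 3 / 2) = A at *
    generalize Gamma ((j : ℝ) + 1 / 2) = B at *
    field_simp
    linarith
  · rw [aux_gauss_odd, zero_mul] at h
    rw [aux_beta_odd, mul_zero]
    rcases mul_eq_zero.1 h.symm with h | h
    · exact h
    · linarith

lemma aux_poly (m : ℕ) (i : Fin (2 * m + 3)) (p : Polynomial ℝ) :
    ∫ ω : sphere (0 : EuclideanSpace ℝ (Fin (2 * m + 3))) 1,
      p.eval ((ω : EuclideanSpace ℝ (Fin (2 * m + 3))) i)
        ∂((volume : Measure (EuclideanSpace ℝ (Fin (2 * m + 3)))).toSphere) =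
    2 * π ^ (m + 1) / m.factorial * ∫ u in (-1 : ℝ)..1, p.eval u * (1 - u ^ 2) ^ m := by
  simp only [Polynomial.eval_eq_sum_range, Finset.sum_mul]
  rw [integral_finsetSum, intervalIntegral.integral_finsetSum, Finset.mul_sum]
  · refine Finset.sum_congr rfl fun k _ => ?_
    simp only [mul_assoc]
    rw [integral_const_mul, intervalIntegral.integral_const_mul, aux_moment]
    ring
  · intro k _
    exact Continuous.intervalIntegrable (by fun_prop) _ _
  · intro k _
    refine Continuous.integrable_of_hasCompactSupport (by fun_prop)
      (HasCompactSupport.of_compactSpace _)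

lemma aux_sphere (m : ℕ) (i : Fin (2 * m + 3)) (g : ℝ → ℝ) (hg : Continuous g) :
    ∫ ω : sphere (0 : EuclideanSpace ℝ (Fin (2 * m + 3))) 1,
      g ((ω : EuclideanSpace ℝ (Fin (2 * m + 3))) i)
        ∂((volume : Measure (EuclideanSpace ℝ (Fin (2 * m + 3)))).toSphere) =
    2 * π ^ (m + 1) / m.factorial * ∫ u in (-1 : ℝ)..1, g u * (1 - u ^ 2) ^ m := by
  set σ := (volume : Measure (EuclideanSpace ℝ (Fin (2 * m + 3)))).toSphere
  set c : ℝ := 2 * π ^ (m + 1) / m.factorial with hc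
  have hc0 : 0 ≤ c := by positivity
  have key : ∀ ε > 0, |∫ ω : sphere (0 : EuclideanSpace ℝ (Fin (2 * m + 3))) 1,
      g ((ω : EuclideanSpace ℝ (Fin (2 * m + 3))) i) ∂σ -
      c * ∫ u in (-1 : ℝ)..1, g u * (1 - u ^ 2) ^ m| ≤ ε * (σ.real univ + c * 2) := by
    intro ε hε
    obtain ⟨p, hp⟩ := exists_polynomial_near_of_continuousOn (-1) 1 g hg.continuousOn ε hε
    have e := aux_poly m i p
    have hpc : Continuous fun u => p.eval u := p.continuous
    have h1 : |∫ ω : sphere (0 : EuclideanSpace ℝ (Fin (2 * m + 3))) 1,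
        (g ((ω : EuclideanSpace ℝ (Fin (2 * m + 3))) i) -
        p.eval ((ω : EuclideanSpace ℝ (Fin (2 * m + 3))) i)) ∂σ| ≤ ε * σ.real univ := by
      rw [← norm_eq_abs]
      refine norm_integral_le_of_norm_le_const (μ := σ) (Eventually.of_forall fun ω => ?_)
      have hω : |(ω : EuclideanSpace ℝ (Fin (2 * m + 3))) i| ≤ 1 := by
        have := PiLp.norm_apply_le (ω : EuclideanSpace ℝ (Fin (2 * m + 3))) i
        rw [norm_eq_of_mem_sphere ω] at this
        exact this
      rw [norm_eq_abs, abs_sub_comm]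
      exact (hp _ (abs_le.1 hω)).le
    have h2 : |∫ u in (-1 : ℝ)..1, (g u - p.eval u) * (1 - u ^ 2) ^ m| ≤ ε * 2 := by
      have := intervalIntegral.norm_integral_le_of_norm_le_const (a := -1) (b := 1) (C := ε)
        (f := fun u : ℝ => (g u - p.eval u) * (1 - u ^ 2) ^ m) (fun u hu => ?_)
      · rw [norm_eq_abs] at this
        norm_num at this
        exact this
      · rw [uIoc_of_le (by norm_num)] at hu
        have h3 := (hp u ⟨hu.1.le, hu.2⟩).le
        rw [abs_sub_comm] at h3
        have h4 : 0 ≤ 1 - u ^ 2 := by nlinarith [hu.1, hu.2]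
        rw [norm_eq_abs, abs_mul, abs_of_nonneg (pow_nonneg h4 m)]
        calc _ ≤ ε * 1 := mul_le_mul h3 (pow_le_one₀ h4 (by nlinarith [sq_nonneg u]))
              (by positivity) hε.le
          _ = ε := mul_one _
    rw [integral_sub (Continuous.integrable_of_hasCompactSupport (by fun_prop)
      (HasCompactSupport.of_compactSpace _)) (Continuous.integrable_of_hasCompactSupport
      (by fun_prop) (HasCompactSupport.of_compactSpace _)), e] at h1
    simp only [sub_mul] at h2
    rw [intervalIntegral.integral_sub (Continuous.intervalIntegrable (by fun_prop) _ _)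
      (Continuous.intervalIntegrable (by fun_prop) _ _)] at h2
    have h5 := mul_le_mul_of_nonneg_left h2 hc0
    rw [← abs_of_nonneg hc0, ← abs_mul, abs_of_nonneg hc0] at h5
    rw [abs_le] at *
    constructor <;> linarith [h1.1, h1.2, h5.1, h5.2]
  have hK : 0 < σ.real univ + c * 2 + 1 := by positivity
  rw [← sub_eq_zero, ← abs_nonpos_iff]
  refine le_of_forall_pos_le_add fun ε hε => ?_
  have := key (ε / (σ.real univ + c * 2 + 1)) (by positivity)
  refine this.trans ?_
  rw [zero_add, div_mul_eq_mul_div, div_le_iff₀ hK]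
  nlinarith

lemma aux_iter (p : Polynomial ℝ) (k : ℕ) :
    iteratedDeriv k (fun u : ℝ => p.eval u) =
      fun u => (Polynomial.derivative^[k] p).eval u := by
  induction k with
  | zero => simp
  | succ k ih =>
    rw [iteratedDeriv_succ, ih]
    funext u
    rw [Polynomial.deriv, Function.iterate_succ_apply']

lemma aux_parts (G : ℝ → ℝ) (r t : ℝ) (k : ℕ) : ContDiff ℝ k G → ∀ R : Polynomial ℝ,
    r ^ k * ∫ u in (-1 : ℝ)..1, iteratedDeriv k G (r * u + t) *
        ((Polynomial.X ^ 2 - 1) ^ k * R).eval u =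
      (-1) ^ k * ∫ u in (-1 : ℝ)..1, G (r * u + t) *
        (Polynomial.derivative^[k] ((Polynomial.X ^ 2 - 1) ^ k * R)).eval u := by
  induction k with
  | zero => intro _ R; simp
  | succ k ih =>
    intro hG R
    have hGk : ContDiff ℝ k G := hG.of_le (by exact_mod_cast Nat.le_succ k)
    have hd : Differentiable ℝ (iteratedDeriv k G) :=
      hG.differentiable_iteratedDeriv k (by exact_mod_cast Nat.lt_succ_self k)
    have hc : Continuous (iteratedDeriv (k + 1) G) :=
      hG.continuous_iteratedDeriv (k + 1) le_rfl
    set Q : Polynomial ℝ := (Polynomial.X ^ 2 - 1) ^ (k + 1) * R with hQ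
    obtain ⟨R', hR'⟩ : ∃ R' : Polynomial ℝ,
        Polynomial.derivative Q = (Polynomial.X ^ 2 - 1) ^ k * R' := by
      refine ⟨((k : Polynomial ℝ) + 1) * (2 * Polynomial.X) * R +
        (Polynomial.X ^ 2 - 1) * Polynomial.derivative R, ?_⟩
      rw [hQ, Polynomial.derivative_mul, Polynomial.derivative_pow]
      simp
      ring
    have hp := intervalIntegral.integral_mul_deriv_eq_deriv_mul (a := -1) (b := 1)
      (u := fun u => Q.eval u) (u' := fun u => (Polynomial.derivative Q).eval u)
      (v := fun u => iteratedDeriv k G (r * u + t))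
      (v' := fun u => iteratedDeriv (k + 1) G (r * u + t) * r)
      (fun x _ => Q.hasDerivAt x)
      (fun x _ => by
        have h1 : HasDerivAt (fun u : ℝ => r * u + t) r x := by
          simpa using ((hasDerivAt_id x).const_mul r).add_const t
        have h2 := (hd (r * x + t)).hasDerivAt
        rw [← iteratedDeriv_succ] at h2
        exact h2.comp x h1)
      ((Polynomial.derivative Q).continuous.intervalIntegrable _ _)
      (Continuous.intervalIntegrable (by fun_prop) _ _)
    have hQ1 : Q.eval 1 = 0 := by simp [hQ]
    have hQ2 : Q.eval (-1) = 0 := by simp [hQ]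
    rw [hQ1, hQ2] at hp
    have e1 : r * ∫ u in (-1 : ℝ)..1, iteratedDeriv (k + 1) G (r * u + t) * Q.eval u =
        - ∫ u in (-1 : ℝ)..1, iteratedDeriv k G (r * u + t) *
          ((Polynomial.X ^ 2 - 1) ^ k * R').eval u := by
      rw [← intervalIntegral.integral_const_mul, ← hR']
      calc _ = ∫ u in (-1 : ℝ)..1, Q.eval u * (iteratedDeriv (k + 1) G (r * u + t) * r) := by
            congr 1; funext u; ring
        _ = _ := by
            rw [hp]
            simp only [zero_mul, sub_self, zero_sub, mul_comm]
    have := ih hGk R'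
    rw [Function.iterate_succ_apply, hR', pow_succ, mul_assoc, e1, mul_neg, this, pow_succ]
    ring

/-- The spherical-mean form of the radial explicit formula:
`(2π)^{-μ} ∫_{S^{d-1}} G^{(μ-1)}(rω₁+t) dσ(ω) = r^{-(d-1)/2} ∫_{t-r}^{t+r} G(s)
P_{(d-3)/2}((s-t)/r) ds` with `μ = (d-1)/2`. -/
theorem stmt15 (d : ℕ) (hd : 3 ≤ d) (hodd : Odd d) (G : ℝ → ℝ)
    (hG : ContDiff ℝ ((d - 1) / 2 - 1 : ℕ) G) (r : ℝ) (hr : 0 < r) (t : ℝ) :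
    (2 * π) ^ (-(((d : ℝ) - 1) / 2)) *
        ∫ ω : sphere (0 : EuclideanSpace ℝ (Fin d)) 1,
          iteratedDeriv ((d - 1) / 2 - 1) G
            (r * (ω : EuclideanSpace ℝ (Fin d)) (⟨0, by omega⟩ : Fin d) + t)
          ∂((volume : Measure (EuclideanSpace ℝ (Fin d))).toSphere) =
      r ^ (-(((d : ℝ) - 1) / 2)) *
        ∫ s in (t - r)..(t + r), G s * legendreP ((d - 3) / 2) ((s - t) / r) := by
  obtain ⟨m, rfl⟩ : ∃ m, d = 2 * m + 3 := by
    obtain ⟨n, rfl⟩ := hodd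
    exact ⟨n - 1, by omega⟩
  have em : (2 * m + 3 - 1) / 2 - 1 = m := by omega
  have em' : (2 * m + 3 - 3) / 2 = m := by omega
  simp only [em, em'] at hG ⊢
  have ee : -((((2 * m + 3 : ℕ) : ℝ) - 1) / 2) = -((m + 1 : ℕ) : ℝ) := by push_cast; ring
  rw [ee, rpow_neg (by positivity), rpow_natCast, rpow_neg hr.le, rpow_natCast]
  have hc : Continuous (iteratedDeriv m G) := hG.continuous_iteratedDeriv m le_rfl
  rw [aux_sphere m _ (fun x => iteratedDeriv m G (r * x + t)) (by fun_prop)]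
  have hparts := aux_parts G r t m hG 1
  rw [mul_one] at hparts
  have hev : (fun y : ℝ => (y ^ 2 - 1) ^ m) =
      fun y => ((Polynomial.X ^ 2 - 1 : Polynomial ℝ) ^ m).eval y := by
    funext y; simp
  have hsub := intervalIntegral.integral_comp_mul_add (a := -1) (b := 1)
    (fun s => G s * legendreP m ((s - t) / r)) hr.ne' t
  have hL : ∀ u : ℝ, legendreP m ((r * u + t - t) / r) = 1 / ((2 : ℝ) ^ m * (m.factorial : ℝ)) *
      (Polynomial.derivative^[m] ((Polynomial.X ^ 2 - 1 : Polynomial ℝ) ^ m)).eval u := by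
    intro u
    rw [legendreP, hev, aux_iter, add_sub_cancel_right, mul_div_cancel_left₀ _ hr.ne']
  have hs2 : ∫ s in (t - r)..(t + r), G s * legendreP m ((s - t) / r) =
      r * (1 / ((2 : ℝ) ^ m * (m.factorial : ℝ)) * ∫ u in (-1 : ℝ)..1, G (r * u + t) *
        (Polynomial.derivative^[m] ((Polynomial.X ^ 2 - 1 : Polynomial ℝ) ^ m)).eval u) := by
    rw [show r * -1 + t = t - r by ring, show r * 1 + t = t + r by ring] at hsub
    simp only [hL] at hsub
    rw [← intervalIntegral.integral_const_mul, eq_comm, ← eq_inv_mul_iff_mul_eq₀ hr.ne',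
      ← smul_eq_mul (a := r⁻¹), ← hsub]
    congr 1; funext u; ring
  have hs3 : ∫ u in (-1 : ℝ)..1, iteratedDeriv m G (r * u + t) * (1 - u ^ 2) ^ m =
      (-1) ^ m * ∫ u in (-1 : ℝ)..1, iteratedDeriv m G (r * u + t) *
        ((Polynomial.X ^ 2 - 1 : Polynomial ℝ) ^ m).eval u := by
    rw [← intervalIntegral.integral_const_mul]
    congr 1; funext u
    simp only [Polynomial.eval_pow, Polynomial.eval_sub, Polynomial.eval_X, Polynomial.eval_one]
    rw [show 1 - u ^ 2 = (-1) * (u ^ 2 - 1) by ring, mul_pow]; ring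
  rw [hs2, hs3]
  set A := ∫ u in (-1 : ℝ)..1, iteratedDeriv m G (r * u + t) *
        ((Polynomial.X ^ 2 - 1 : Polynomial ℝ) ^ m).eval u
  set B := ∫ u in (-1 : ℝ)..1, G (r * u + t) *
        (Polynomial.derivative^[m] ((Polynomial.X ^ 2 - 1 : Polynomial ℝ) ^ m)).eval u
  have hB : B = (-1) ^ m * (r ^ m * A) := by
    rw [hparts, ← mul_assoc, ← mul_pow]; simp
  rw [hB]
  have hfac : (m.factorial : ℝ) ≠ 0 := by positivity
  have hpi := pi_pos.ne'
  rw [mul_pow]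
  field_simp
  ring
end
end
end

section
/- Let d ≥ 3 be an odd integer, β ∈ (1/2, 3/2), and let p, q, p̃, q̃ ∈ [1, ∞) satisfy 1/p + d/q = d/2 − β and 1/p̃ + d/q̃ = d/2 − β + 2. Let j, k ∈ ℤ with j ≤ k, and let F : ℝ^d × ℝ → ℝ be continuous, radial in the space variable, supported in Ω_k, with ‖F‖_{L^{p̃} L^{q̃}(ℝ × ℝ^d)} < ∞. Define, for t > 0, u(x, t) = ∫_0^t [ ((1/s) d/ds)^{(d−3)/2} ( s^{d−2} ∫_{S^{d−1}} F(x + sω, τ) dσ(ω) ) ]|_{s = t−τ} dτ. Then there is a constant C = C(d, β, p, q, p̃, q̃), independent of j, k and F, such that ‖χ_j u‖_{L^p L^q([0,∞) × ℝ^d)} ≤ C 2^{(j−k)/q} ‖F‖_{L^{p̃} L^{q̃}(ℝ × ℝ^d)}. -/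
open MeasureTheory Real Set Filter Metric
open scoped FourierTransform ENNReal NNReal Topology

noncomputable section

/-- The operator `f ↦ (1/s) df/ds`. -/
def radialOp (f : ℝ → ℝ) : ℝ → ℝ := fun s => deriv f s / s

lemma lint_polar {E : Type*} [NormedAddCommGroup E] [NormedSpace ℝ E] [MeasurableSpace E]
    [BorelSpace E] [FiniteDimensional ℝ E] [Nontrivial E] (μ : Measure E) [μ.IsAddHaarMeasure]
    (H : E → ℝ≥0∞) (hH : Measurable H) :
    ∫⁻ y, H y ∂μ = ∫⁻ ω : sphere (0 : E) 1, ∫⁻ r in Ioi (0 : ℝ),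
      ENNReal.ofReal (r ^ (Module.finrank ℝ E - 1)) * H (r • (ω : E)) ∂volume ∂μ.toSphere := by
  calc
    ∫⁻ y, H y ∂μ = ∫⁻ x : ({(0)}ᶜ : Set E), H x ∂(μ.comap (↑)) := by
      rw [lintegral_subtype_comap (measurableSet_singleton _).compl (fun x => H x),
        restrict_compl_singleton]
    _ = ∫⁻ x, H (x.2.1 • x.1.1) ∂μ.toSphere.prod (.volumeIoiPow (Module.finrank ℝ E - 1)) := by
      rw [← μ.measurePreserving_homeomorphUnitSphereProd.lintegral_comp_emb
        (Homeomorph.measurableEmbedding _)]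
      refine lintegral_congr fun x => ?_
      have : ‖x.1‖ ≠ 0 := norm_ne_zero_iff.2 x.2
      simp [smul_smul, this]
    _ = ∫⁻ ω, ∫⁻ r : Ioi (0 : ℝ), H (r.1 • ω.1) ∂(.volumeIoiPow (Module.finrank ℝ E - 1))
        ∂μ.toSphere := by
      rw [lintegral_prod]
      refine Measurable.aemeasurable ?_
      exact hH.comp (by fun_prop)
    _ = _ := by
      refine lintegral_congr fun ω => ?_
      have hm : Measurable (fun r : ℝ => H (r • ω.1)) := hH.comp (by fun_prop)
      rw [Measure.volumeIoiPow, lintegral_withDensity_eq_lintegral_mul _ (by fun_prop)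
        (show Measurable (fun r : Ioi (0:ℝ) => H (r.1 • ω.1)) from hm.comp measurable_subtype_coe)]
      rw [← lintegral_subtype_comap measurableSet_Ioi
        (fun r => ENNReal.ofReal (r ^ (Module.finrank ℝ E - 1)) * H (r • (ω : E)))]
      rfl

lemma lint_radial {E : Type*} [NormedAddCommGroup E] [NormedSpace ℝ E] [MeasurableSpace E]
    [BorelSpace E] [FiniteDimensional ℝ E] [Nontrivial E] (μ : Measure E) [μ.IsAddHaarMeasure]
    (h : ℝ → ℝ≥0∞) (hh : Measurable h) :
    ∫⁻ y, h ‖y‖ ∂μ = μ.toSphere univ * ∫⁻ r in Ioi (0 : ℝ),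
      ENNReal.ofReal (r ^ (Module.finrank ℝ E - 1)) * h r := by
  rw [lint_polar μ (fun y => h ‖y‖) (hh.comp measurable_norm)]
  rw [mul_comm, ← lintegral_const]
  refine lintegral_congr fun ω => setLIntegral_congr_fun measurableSet_Ioi fun r hr => ?_
  have : ‖(ω : E)‖ = 1 := by simp
  simp [norm_smul, this, abs_of_pos (show (0:ℝ) < r from hr)]

/-- split a Euclidean space -/
lemma lint_split (n : ℕ) (e : EuclideanSpace ℝ (Fin (n + 1))) (he : ‖e‖ = 1)
    (Φ : ℝ → ℝ → ℝ≥0∞) (hΦ : Measurable (fun z : ℝ × ℝ => Φ z.1 z.2)) :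
    ∫⁻ y : EuclideanSpace ℝ (Fin (n + 1)), Φ (inner ℝ e y) ‖y‖ =
      ∫⁻ a : ℝ, ∫⁻ y : EuclideanSpace ℝ (Fin n), Φ a (√ (a ^ 2 + ‖y‖ ^ 2)) := by
  obtain ⟨b, hb⟩ : ∃ b : OrthonormalBasis (Fin (n + 1)) ℝ (EuclideanSpace ℝ (Fin (n + 1))),
      b 0 = e := by
    have ho : Orthonormal ℝ (({0} : Set (Fin (n + 1))).domRestrict (fun _ => e)) := by
      constructor
      · intro i; exact he
      · intro i j hij
        exact absurd (Subsingleton.elim i j) hij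
    obtain ⟨b, hb⟩ := ho.exists_orthonormalBasis_extension_of_card_eq (by simp)
    exact ⟨b, hb 0 (by simp)⟩
  have h1 : ∫⁻ y : EuclideanSpace ℝ (Fin (n + 1)), Φ (inner ℝ e y) ‖y‖ =
      ∫⁻ y : EuclideanSpace ℝ (Fin (n + 1)), Φ (y 0) ‖y‖ := by
    rw [← b.measurePreserving_repr.lintegral_comp_emb
      (b.repr.toHomeomorph.measurableEmbedding) (fun y => Φ (y 0) ‖y‖)]
    refine lintegral_congr fun y => ?_
    simp [b.repr_apply_apply, hb]
  rw [h1]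
  have h2 : ∫⁻ y : EuclideanSpace ℝ (Fin (n + 1)), Φ (y 0) ‖y‖ =
      ∫⁻ y : Fin (n + 1) → ℝ, Φ (y 0) (√ (∑ i, y i ^ 2)) := by
    rw [← (PiLp.volume_preserving_ofLp (Fin (n+1))).lintegral_comp_emb
      (MeasurableEquiv.toLp 2 _).symm.measurableEmbedding]
    refine lintegral_congr fun y => ?_
    simp [EuclideanSpace.norm_eq]
  rw [h2, ← (volume_preserving_piFinSuccAbove (fun _ => ℝ) (0 : Fin (n+1))).symm.lintegral_comp_emb
     (MeasurableEquiv.measurableEmbedding _)]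
  rw [Measure.volume_eq_prod, lintegral_prod]
  · refine lintegral_congr fun a => ?_
    rw [← (PiLp.volume_preserving_ofLp (Fin n)).lintegral_comp_emb
      (MeasurableEquiv.toLp 2 _).symm.measurableEmbedding]
    refine lintegral_congr fun y => ?_
    rw [EuclideanSpace.norm_eq, Real.sq_sqrt (by positivity)]
    simp [Fin.sum_univ_succ, MeasurableEquiv.piFinSuccAbove_symm_apply]
  · refine Measurable.aemeasurable ?_
    have : Measurable (fun y : Fin (n+1) → ℝ => Φ (y 0) (√ (∑ i, y i ^ 2))) := by
      have h3 : Measurable (fun y : Fin (n+1) → ℝ => (y 0, (√ (∑ i, y i ^ 2)))) := by fun_prop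
      exact hΦ.comp h3
    exact this.comp (MeasurableEquiv.measurable _)

lemma slice_lint_s17 (k : ℕ) (e : EuclideanSpace ℝ (Fin (k + 1 + 1))) (he : ‖e‖ = 1)
    (g : ℝ → ℝ≥0∞) (hg : Measurable g) :
    ∫⁻ ω : sphere (0 : EuclideanSpace ℝ (Fin (k + 1 + 1))) 1,
        g (inner ℝ e (ω : EuclideanSpace ℝ (Fin (k + 1 + 1))))
        ∂((volume : Measure (EuclideanSpace ℝ (Fin (k + 1 + 1)))).toSphere) =
      (volume : Measure (EuclideanSpace ℝ (Fin (k + 1)))).toSphere univ *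
        ∫⁻ θ in Ioo 0 π, ENNReal.ofReal (sin θ ^ k) * g (cos θ) := by
  set c := (volume : Measure (EuclideanSpace ℝ (Fin (k + 1)))).toSphere univ with hc
  set φ : ℝ → ℝ≥0∞ := (Ioo (0:ℝ) 1).indicator 1 with hφ
  have hφm : Measurable φ := measurable_one.indicator measurableSet_Ioo
  set Φ : ℝ → ℝ → ℝ≥0∞ := fun a ρ => φ ρ * g (a / ρ) with hΦ
  have hΦm : Measurable (fun z : ℝ × ℝ => Φ z.1 z.2) := by
    refine (hφm.comp measurable_snd).mul (hg.comp (by fun_prop))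
  set M : ℝ≥0∞ := ∫⁻ r in Ioi (0:ℝ), ENNReal.ofReal (r ^ (k+1)) * φ r with hM
  have hMm : Measurable fun r : ℝ => ENNReal.ofReal (r ^ (k+1)) * φ r := by
    exact Measurable.mul (by fun_prop) hφm
  have hM' : M = ∫⁻ r in Ioo (0:ℝ) 1, ENNReal.ofReal (r ^ (k+1)) := by
    rw [hM, ← lintegral_indicator measurableSet_Ioi, ← lintegral_indicator measurableSet_Ioo]
    refine lintegral_congr fun r => ?_
    by_cases h1 : 0 < r <;> by_cases h2 : r < 1 <;> simp [hφ, indicator, h1, h2]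
  have hM0 : M ≠ 0 := by
    rw [hM']
    refine (setLIntegral_pos_iff (by fun_prop)).2 ?_ |>.ne'
    rw [inter_eq_right.2]
    · simp
    · intro r hr
      simp only [Function.mem_support, ne_eq, ENNReal.ofReal_eq_zero, not_le]
      exact pow_pos hr.1 _
  have hMt : M ≠ ⊤ := by
    rw [hM']
    refine (lt_of_le_of_lt (setLIntegral_mono (g := fun _ => 1) measurable_const ?_) ?_).ne
    · intro r hr
      rw [ENNReal.ofReal_le_one]
      exact pow_le_one₀ hr.1.le hr.2.le
    · simp
  have hA : ∫⁻ y : EuclideanSpace ℝ (Fin (k + 1 + 1)), Φ (inner ℝ e y) ‖y‖ =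
      (∫⁻ ω : sphere (0 : EuclideanSpace ℝ (Fin (k + 1 + 1))) 1,
        g (inner ℝ e (ω : EuclideanSpace ℝ (Fin (k + 1 + 1))))
        ∂((volume : Measure (EuclideanSpace ℝ (Fin (k + 1 + 1)))).toSphere)) * M := by
    rw [lint_polar volume (fun y => Φ (inner ℝ e y) ‖y‖)]
    · rw [← lintegral_mul_const]
      · refine lintegral_congr fun ω => ?_
        rw [hM, ← lintegral_const_mul _ hMm]
        refine setLIntegral_congr_fun measurableSet_Ioi fun r hr => ?_
        have h1 : ‖(ω : EuclideanSpace ℝ (Fin (k + 1 + 1)))‖ = 1 := by simp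
        have hr : 0 < r := hr
        simp only [finrank_euclideanSpace, Fintype.card_fin, Nat.add_sub_cancel, hΦ, norm_smul, h1,
          Real.norm_eq_abs, abs_of_pos hr, mul_one, inner_smul_right]
        rw [mul_div_cancel_left₀ _ hr.ne']
        ring
      · exact hg.comp (by fun_prop)
    · have h3 : Measurable (fun y : EuclideanSpace ℝ (Fin (k + 1 + 1)) => (inner ℝ e y, ‖y‖)) := by
        fun_prop
      exact hΦm.comp h3
  have hB : ∫⁻ y : EuclideanSpace ℝ (Fin (k + 1 + 1)), Φ (inner ℝ e y) ‖y‖ =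
      c * (∫⁻ θ in Ioo 0 π, ENNReal.ofReal (sin θ ^ k) * g (cos θ)) * M := by
    rw [lint_split (k+1) e he Φ hΦm]
    have hradm : Measurable (fun z : ℝ × ℝ => ENNReal.ofReal (z.2 ^ k) *
        Φ z.1 √(z.1 ^ 2 + z.2 ^ 2)) := by
      have h3 : Measurable (fun z : ℝ × ℝ => (z.1, √(z.1 ^ 2 + z.2 ^ 2))) := by fun_prop
      exact Measurable.mul (by fun_prop) (hΦm.comp h3)
    have hrad : ∀ a : ℝ, ∫⁻ y : EuclideanSpace ℝ (Fin (k+1)), Φ a √(a ^ 2 + ‖y‖ ^ 2) =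
        c * ∫⁻ ρ in Ioi (0:ℝ), ENNReal.ofReal (ρ ^ k) * Φ a √(a ^ 2 + ρ ^ 2) := by
      intro a
      have := lint_radial (volume : Measure (EuclideanSpace ℝ (Fin (k+1))))
        (fun ρ => Φ a √(a ^ 2 + ρ ^ 2)) (by
          have h3 : Measurable (fun ρ : ℝ => (a, √(a ^ 2 + ρ ^ 2))) := by fun_prop
          exact hΦm.comp h3)
      simpa only [finrank_euclideanSpace, Fintype.card_fin, Nat.add_sub_cancel] using this
    simp_rw [hrad]
    set G : ℝ × ℝ → ℝ≥0∞ := (univ ×ˢ Ioi 0).indicator (fun z : ℝ × ℝ => ENNReal.ofReal (z.2 ^ k) *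
        Φ z.1 √(z.1 ^ 2 + z.2 ^ 2)) with hG
    have hGm : Measurable G := hradm.indicator (MeasurableSet.univ.prod measurableSet_Ioi)
    have h4 : ∀ a : ℝ, ∫⁻ ρ in Ioi (0:ℝ), ENNReal.ofReal (ρ ^ k) * Φ a √(a ^ 2 + ρ ^ 2) =
        ∫⁻ ρ, G (a, ρ) := by
      intro a
      rw [← lintegral_indicator measurableSet_Ioi]
      refine lintegral_congr fun ρ => ?_
      simp [hG, indicator]
    simp_rw [h4]
    rw [lintegral_const_mul _ (hGm.lintegral_prod_right'), mul_assoc]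
    congr 1
    rw [← lintegral_prod _ hGm.aemeasurable, ← Measure.volume_eq_prod,
      ← lintegral_comp_polarCoord_symm, polarCoord_target, Measure.volume_eq_prod,
      ← Measure.prod_restrict, lintegral_prod]
    · rw [mul_comm, hM, ← lintegral_mul_const _ hMm]
      refine setLIntegral_congr_fun measurableSet_Ioi fun r hr => ?_
      have hr : 0 < r := hr
      have hsm : Measurable fun θ : ℝ => ENNReal.ofReal (sin θ ^ k) * g (cos θ) :=
        Measurable.mul (by fun_prop) (hg.comp (by fun_prop))
      simp only []
      rw [← lintegral_const_mul _ hsm, ← lintegral_indicator measurableSet_Ioo,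
        ← lintegral_indicator measurableSet_Ioo]
      refine lintegral_congr fun θ => ?_
      have hsq : √((r * cos θ) ^ 2 + (r * sin θ) ^ 2) = r := by
        rw [show (r * cos θ) ^ 2 + (r * sin θ) ^ 2 = r ^ 2 * (cos θ ^ 2 + sin θ ^ 2) by ring,
          cos_sq_add_sin_sq, mul_one, Real.sqrt_sq hr.le]
      by_cases h1 : θ ∈ Ioo 0 π
      · have h2 : θ ∈ Ioo (-π) π := ⟨by linarith [h1.1, pi_pos], h1.2⟩
        have h3 : 0 < sin θ := sin_pos_of_mem_Ioo h1
        have h5 : 0 < r * sin θ := by positivity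
        rw [indicator_of_mem h1, indicator_of_mem h2]
        simp only [polarCoord_symm_apply, hG, indicator, mem_prod, mem_univ, true_and, mem_Ioi, h5,
          if_true, hsq, hΦ, mul_div_cancel_left₀ _ hr.ne', smul_eq_mul]
        rw [show r ^ (k+1) = r * r ^ k by ring, mul_pow, ENNReal.ofReal_mul hr.le,
          ENNReal.ofReal_mul (by positivity)]
        ring
      · rw [indicator_of_notMem h1]
        by_cases h2 : θ ∈ Ioo (-π) π
        · rw [indicator_of_mem h2]
          have h3 : sin θ ≤ 0 := by
            have : θ ≤ 0 := by
              by_contra h; exact h1 ⟨not_le.1 h, h2.2⟩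
            exact sin_nonpos_of_nonpos_of_neg_pi_le this h2.1.le
          have h5 : ¬ (0 < r * sin θ) := not_lt.2 (mul_nonpos_of_nonneg_of_nonpos hr.le h3)
          simp only [polarCoord_symm_apply, hG, indicator, mem_prod, mem_univ, true_and, mem_Ioi, h5,
            if_false, smul_zero]
        · rw [indicator_of_notMem h2]
    · refine Measurable.aemeasurable ?_
      have h6 : Measurable (fun z : ℝ × ℝ => polarCoord.symm z) := by
        simp only [polarCoord_symm_apply]
        fun_prop
      exact Measurable.mul (by fun_prop) (hGm.comp h6)
  exact (ENNReal.mul_left_inj hM0 hMt).1 (hA.symm.trans hB)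

lemma slice_integral (k : ℕ) (e : EuclideanSpace ℝ (Fin (k + 1 + 1))) (he : ‖e‖ = 1)
    (h : ℝ → ℝ) (hh : Continuous h) :
    ∫ ω : sphere (0 : EuclideanSpace ℝ (Fin (k + 1 + 1))) 1,
        h (inner ℝ e (ω : EuclideanSpace ℝ (Fin (k + 1 + 1))))
        ∂((volume : Measure (EuclideanSpace ℝ (Fin (k + 1 + 1)))).toSphere) =
      (volume : Measure (EuclideanSpace ℝ (Fin (k + 1)))).toSphere.real univ *
        ∫ θ in (0:ℝ)..π, h (cos θ) * sin θ ^ k := by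
  set σ := ((volume : Measure (EuclideanSpace ℝ (Fin (k + 1 + 1)))).toSphere)
  set c := (volume : Measure (EuclideanSpace ℝ (Fin (k + 1)))).toSphere univ with hc
  set I : sphere (0 : EuclideanSpace ℝ (Fin (k + 1 + 1))) 1 → ℝ :=
    fun ω => inner ℝ e (ω : EuclideanSpace ℝ (Fin (k + 1 + 1))) with hI
  have hIm : Measurable I := by fun_prop
  set w : ℝ → ℝ≥0 := fun θ => Real.toNNReal (sin θ ^ k) with hw
  have hwm : Measurable w := by fun_prop
  set ν := (volume.restrict (Ioo 0 π)).withDensity (fun θ => (w θ : ℝ≥0∞)) with hν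
  have hmap : Measure.map I σ = c • Measure.map cos ν := by
    ext s hs
    have := slice_lint_s17 k e he (s.indicator 1) (measurable_one.indicator hs)
    rw [Measure.smul_apply, smul_eq_mul]
    rw [← lintegral_indicator_one hs, lintegral_map (measurable_one.indicator hs) hIm]
    rw [this, ← lintegral_indicator_one hs,
      lintegral_map (measurable_one.indicator hs) (by fun_prop), hν,
      lintegral_withDensity_eq_lintegral_mul _ (show Measurable fun θ => (w θ : ℝ≥0∞) by fun_prop)
        (show Measurable (fun θ => s.indicator (1 : ℝ → ℝ≥0∞) (cos θ)) from
          (measurable_one.indicator hs).comp measurable_cos)]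
    rfl
  have h1 : ∫ ω, h (I ω) ∂σ = ∫ z, h z ∂(Measure.map I σ) :=
    (integral_map hIm.aemeasurable hh.aestronglyMeasurable).symm
  rw [h1, hmap, integral_smul_measure, integral_map (by fun_prop) hh.aestronglyMeasurable, hν,
    integral_withDensity_eq_integral_smul hwm, intervalIntegral.integral_of_le pi_pos.le,
    integral_Ioc_eq_integral_Ioo, Measure.real, smul_eq_mul]
  congr 1
  refine setIntegral_congr_fun measurableSet_Ioo fun θ hθ => ?_
  have h3 : 0 < sin θ := sin_pos_of_mem_Ioo hθ
  simp only [hw, NNReal.smul_def, Real.coe_toNNReal _ (pow_pos h3 k).le, smul_eq_mul]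
  ring

lemma slice_integral' (m : ℕ) : ∃ c : ℝ, 0 ≤ c ∧ ∀ (e : EuclideanSpace ℝ (Fin (2 * m + 3))), ‖e‖ = 1 →
    ∀ (h : ℝ → ℝ), Continuous h →
    ∫ ω : sphere (0 : EuclideanSpace ℝ (Fin (2 * m + 3))) 1,
        h (inner ℝ e (ω : EuclideanSpace ℝ (Fin (2 * m + 3))))
        ∂((volume : Measure (EuclideanSpace ℝ (Fin (2 * m + 3)))).toSphere) =
      c * ∫ z in (-1:ℝ)..1, h z * (1 - z ^ 2) ^ m := by
  refine ⟨(volume : Measure (EuclideanSpace ℝ (Fin (2 * m + 1 + 1)))).toSphere.real univ,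
    measureReal_nonneg, fun e he h hh => ?_⟩
  rw [slice_integral (2 * m + 1) e he h hh]
  congr 1
  have := intervalIntegral.integral_comp_mul_deriv (a := 0) (b := π) (f := cos) (f' := fun θ => - sin θ)
    (g := fun z => h z * (1 - z ^ 2) ^ m) (fun θ _ => hasDerivAt_cos θ) (by fun_prop) (by fun_prop)
  rw [cos_zero, cos_pi] at this
  rw [intervalIntegral.integral_symm 1 (-1), ← this, ← intervalIntegral.integral_neg]
  refine intervalIntegral.integral_congr fun θ _ => ?_
  have : 1 - cos θ ^ 2 = sin θ ^ 2 := by rw [sin_sq]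
  simp only [Function.comp, this]
  ring

def LL (w : ℝ → ℝ) (n : ℕ) (s : ℝ) : ℝ := ∫ y in (-s)..s, w y * (s ^ 2 - y ^ 2) ^ n

lemma LL_zero_deriv (w : ℝ → ℝ) (hw : Continuous w) (s : ℝ) :
    HasDerivAt (LL w 0) (w s + w (-s)) s := by
  have h1 : ∀ a, HasDerivAt (fun u => ∫ y in (0:ℝ)..u, w y) (w a) a := fun a =>
    intervalIntegral.integral_hasDerivAt_right (hw.intervalIntegrable _ _)
      (hw.stronglyMeasurableAtFilter _ _) hw.continuousAt
  have h2 := (h1 s).sub ((h1 (-s)).comp s (hasDerivAt_neg s))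
  have h3 : LL w 0 = (fun u => ∫ y in (0:ℝ)..u, w y) - (fun u => ∫ y in (0:ℝ)..u, w y) ∘ Neg.neg := by
    funext u
    simp only [LL, pow_zero, mul_one, Pi.sub_apply, Function.comp]
    rw [intervalIntegral.integral_interval_sub_left] <;> exact hw.intervalIntegrable _ _
  rw [h3]
  refine h2.congr_deriv ?_
  ring

lemma LL_succ (w : ℝ → ℝ) (hw : Continuous w) (n : ℕ) (s : ℝ) :
    LL w (n+1) s = s ^ 2 * LL w n s - LL (fun y => y ^ 2 * w y) n s := by
  simp only [LL]
  rw [← intervalIntegral.integral_const_mul, ← intervalIntegral.integral_sub]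
  · refine intervalIntegral.integral_congr fun y _ => ?_
    ring
  · exact Continuous.intervalIntegrable (by fun_prop) _ _
  · exact Continuous.intervalIntegrable (by fun_prop) _ _

lemma LL_deriv (n : ℕ) : ∀ (w : ℝ → ℝ) (_ : Continuous w) (s : ℝ),
    HasDerivAt (LL w (n+1)) (2 * (n + 1) * s * LL w n s) s := by
  induction n with
  | zero =>
    intro w hw s
    have h : LL w (0+1) = fun s => s ^ 2 * LL w 0 s - LL (fun y => y ^ 2 * w y) 0 s :=
      funext (LL_succ w hw 0)
    rw [h]
    have := ((hasDerivAt_pow 2 s).mul (LL_zero_deriv w hw s)).sub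
      (LL_zero_deriv (fun y => y ^ 2 * w y) (by fun_prop) s)
    refine this.congr_deriv ?_
    push_cast
    ring
  | succ n ih =>
    intro w hw s
    have h : LL w (n+1+1) = fun s => s ^ 2 * LL w (n+1) s - LL (fun y => y ^ 2 * w y) (n+1) s :=
      funext (LL_succ w hw (n+1))
    rw [h]
    have := ((hasDerivAt_pow 2 s).mul (ih w hw s)).sub
      (ih (fun y => y ^ 2 * w y) (by fun_prop) s)
    refine this.congr_deriv ?_
    rw [LL_succ w hw n s]
    push_cast
    ring

lemma radialOp_LL (r : ℝ) (m : ℕ) (ι : Finset ℕ) (w : ℕ → ℝ → ℝ) (hw : ∀ i, Continuous (w i))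
    (G : ℝ → ℝ) (hG : ∀ s ∈ Ioo 0 r, G s = ∑ i ∈ ι, LL (w i) (m + i) s) (k : ℕ) (hk : k ≤ m) :
    ∀ s ∈ Ioo 0 r, radialOp^[k] G s =
      ∑ i ∈ ι, (2:ℝ) ^ k * ((m + i).descFactorial k : ℝ) * LL (w i) (m + i - k) s := by
  induction k with
  | zero => intro s hs; simpa using hG s hs
  | succ k ih =>
    intro s hs
    have ih := ih (by omega)
    rw [Function.iterate_succ_apply', radialOp]
    have hev : radialOp^[k] G =ᶠ[𝓝 s] fun s => 
        ∑ i ∈ ι, (2:ℝ) ^ k * ((m + i).descFactorial k : ℝ) * LL (w i) (m + i - k) s :=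
      Filter.eventually_of_mem (isOpen_Ioo.mem_nhds hs) ih
    rw [hev.deriv_eq]
    have hd : HasDerivAt (fun s => 
        ∑ i ∈ ι, (2:ℝ) ^ k * ((m + i).descFactorial k : ℝ) * LL (w i) (m + i - k) s)
        (∑ i ∈ ι, (2:ℝ) ^ k * ((m + i).descFactorial k : ℝ) *
          (2 * ((m + i - k : ℕ) : ℝ) * s * LL (w i) (m + i - (k + 1)) s)) s := by
      refine HasDerivAt.fun_sum fun i _ => HasDerivAt.const_mul _ ?_
      obtain ⟨n, hn⟩ : ∃ n, m + i - k = n + 1 := ⟨m + i - k - 1, by omega⟩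
      have hn' : m + i - (k+1) = n := by omega
      rw [hn, hn']
      have := LL_deriv n (w i) (hw i) s
      push_cast
      exact this
    rw [hd.deriv, Finset.sum_div]
    refine Finset.sum_congr rfl fun i _ => ?_
    have hs0 : s ≠ 0 := hs.1.ne'
    rw [Nat.descFactorial_succ]
    push_cast
    field_simp
    ring

lemma spherical_mean (m : ℕ) : ∃ c : ℝ, 0 ≤ c ∧
    ∀ (F : EuclideanSpace ℝ (Fin (2 * m + 3)) → ℝ), Continuous F →
    (∀ x y, ‖x‖ = ‖y‖ → F x = F y) → ∀ e : EuclideanSpace ℝ (Fin (2 * m + 3)), ‖e‖ = 1 →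
    ∀ x : EuclideanSpace ℝ (Fin (2 * m + 3)), ∀ s ∈ Ioo 0 ‖x‖,
    s ^ (2 * m + 1) * ∫ ω : sphere (0 : EuclideanSpace ℝ (Fin (2 * m + 3))) 1,
                  F (x + s • (ω : EuclideanSpace ℝ (Fin (2 * m + 3))))
                  ∂((volume : Measure (EuclideanSpace ℝ (Fin (2 * m + 3)))).toSphere) =
      c / ‖x‖ * ∫ y in (-s)..s, F ((‖x‖ + y) • e) * (‖x‖ + y) *
        ((s ^ 2 - y ^ 2) * (4 * ‖x‖ * (‖x‖ + y) - (s ^ 2 - y ^ 2)) / (4 * ‖x‖ ^ 2)) ^ m := by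
  obtain ⟨c, hc, hslice⟩ := slice_integral' m
  refine ⟨c, hc, fun F hF hrad e he x s hs => ?_⟩
  set r := ‖x‖ with hr
  have hs0 : 0 < s := hs.1
  have hsr : s < r := hs.2
  have hr0 : 0 < r := hs0.trans hsr
  set h : ℝ → ℝ := fun z => F (√(r ^ 2 + s ^ 2 + 2 * r * s * z) • e) with hh
  have hhc : Continuous h := by
    have : Continuous fun z : ℝ => √(r ^ 2 + s ^ 2 + 2 * r * s * z) • e := by fun_prop
    exact hF.comp this
  have hex : ‖r⁻¹ • x‖ = 1 := by
    rw [norm_smul, norm_inv, Real.norm_eq_abs, abs_of_pos hr0, ← hr, inv_mul_cancel₀ hr0.ne']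
  have h1 := hslice (r⁻¹ • x) hex h hhc
  have h2 : ∀ ω : sphere (0 : EuclideanSpace ℝ (Fin (2 * m + 3))) 1,
      F (x + s • (ω : EuclideanSpace ℝ (Fin (2 * m + 3)))) = h (inner ℝ (r⁻¹ • x) ω.1) := by
    intro ω
    apply hrad
    have hω : ‖(ω : EuclideanSpace ℝ (Fin (2 * m + 3)))‖ = 1 := by simp
    rw [norm_smul, he, mul_one, Real.norm_eq_abs, abs_of_nonneg (Real.sqrt_nonneg _)]
    symm
    rw [Real.sqrt_eq_iff_eq_sq _ (norm_nonneg _)]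
    · rw [norm_add_sq_real, inner_smul_right, inner_smul_left, norm_smul, hω, ← hr]
      simp
      field_simp
      ring
    · rw [inner_smul_left]
      simp only [conj_trivial]
      have := norm_add_sq_real x (s • ω.1)
      rw [inner_smul_right, norm_smul, hω, ← hr, Real.norm_eq_abs, mul_one, sq_abs] at this
      have h0 : 0 ≤ ‖x + s • ω.1‖ ^ 2 := by positivity
      have h3 : 2 * r * s * (r⁻¹ * inner ℝ x ω.1) = 2 * (s * inner ℝ x ω.1) := by field_simp
      rw [h3]
      linarith
  rw [integral_congr_ae (Eventually.of_forall h2), h1]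
  have h4 := intervalIntegral.integral_comp_mul_deriv (a := -s) (b := s)
    (f := fun y => ((r + y) ^ 2 - r ^ 2 - s ^ 2) / (2 * r * s)) (f' := fun y => (r + y) / (r * s))
    (g := fun z => h z * (1 - z ^ 2) ^ m) (fun y _ => by
      have := ((((hasDerivAt_id y).const_add r).pow 2).sub_const (r ^ 2)).sub_const (s ^ 2) |>.div_const
        (2 * r * s)
      refine this.congr_deriv ?_
      simp only [Nat.cast_ofNat, id]
      field_simp
      ring) (by fun_prop) (by fun_prop)
  have e1 : ((r + s) ^ 2 - r ^ 2 - s ^ 2) / (2 * r * s) = 1 := by field_simp; ring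
  have e2 : ((r + -s) ^ 2 - r ^ 2 - s ^ 2) / (2 * r * s) = -1 := by field_simp; ring
  simp only [e1, e2] at h4
  rw [← h4]
  rw [← mul_assoc, ← intervalIntegral.integral_const_mul, ← intervalIntegral.integral_const_mul]
  refine intervalIntegral.integral_congr fun y hy => ?_
  rw [uIcc_of_le (by linarith)] at hy
  have hy0 : 0 ≤ r + y := by linarith [hy.1]
  have e3 : r ^ 2 + s ^ 2 + 2 * r * s * (((r + y) ^ 2 - r ^ 2 - s ^ 2) / (2 * r * s)) = (r + y) ^ 2 := by
    field_simp; ring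
  have e4 : ((s ^ 2 - y ^ 2) * (4 * r * (r + y) - (s ^ 2 - y ^ 2)) / (4 * r ^ 2)) =
    s ^ 2 * (1 - (((r + y) ^ 2 - r ^ 2 - s ^ 2) / (2 * r * s)) ^ 2) := by field_simp; ring
  simp only [Function.comp, hh]
  rw [e3, e4, Real.sqrt_sq hy0, mul_pow]
  field_simp
  ring

lemma pointwise_bound (m : ℕ) : ∃ C : ℝ, 0 ≤ C ∧
    ∀ (F : EuclideanSpace ℝ (Fin (2 * m + 3)) → ℝ), Continuous F →
    (∀ x y, ‖x‖ = ‖y‖ → F x = F y) → ∀ e : EuclideanSpace ℝ (Fin (2 * m + 3)), ‖e‖ = 1 →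
    ∀ x : EuclideanSpace ℝ (Fin (2 * m + 3)), ∀ s ∈ Ioo 0 ‖x‖,
    |radialOp^[m] (fun s : ℝ => s ^ (2 * m + 1) *
        ∫ ω : sphere (0 : EuclideanSpace ℝ (Fin (2 * m + 3))) 1,
                  F (x + s • (ω : EuclideanSpace ℝ (Fin (2 * m + 3))))
                  ∂((volume : Measure (EuclideanSpace ℝ (Fin (2 * m + 3)))).toSphere)) s| ≤
      C / ‖x‖ ^ (m + 1) * ∫ ρ in (‖x‖ - s)..(‖x‖ + s), |F (ρ • e)| * ρ ^ (m + 1) := by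
  obtain ⟨c, hc, hmean⟩ := spherical_mean m
  set A : ℝ := ∑ i ∈ Finset.range (m+1), (2:ℝ) ^ m * ((m + i).descFactorial m : ℝ) * (m.choose i : ℝ)
    with hA
  have hA0 : 0 ≤ A := Finset.sum_nonneg fun i _ => by positivity
  refine ⟨c * A, by positivity, fun F hF hrad e he x s hs => ?_⟩
  have hmean := hmean F hF hrad e he x
  set r := ‖x‖ with hr
  have hs0 : 0 < s := hs.1
  have hsr : s < r := hs.2
  have hr0 : 0 < r := hs0.trans hsr
  set w : ℕ → ℝ → ℝ := fun i y => c / r * (F ((r + y) • e) * (r + y) * (1 / (4 * r ^ 2)) ^ m *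
    (-1) ^ i * (4 * r * (r + y)) ^ (m - i) * (m.choose i : ℝ)) with hw
  have hFe : Continuous fun y : ℝ => F ((r + y) • e) := hF.comp (by fun_prop)
  have hwc : ∀ i, Continuous (w i) := by
    intro i
    simp only [hw]
    fun_prop
  have hFr : Continuous fun ρ : ℝ => F (ρ • e) := hF.comp (by fun_prop)
  rw [radialOp_LL r m (Finset.range (m+1)) w hwc _ ?_ m le_rfl s hs]
  · have hI : ∫ y in (-s)..s, |F ((r + y) • e)| * (r + y) ^ (m + 1) =
        ∫ ρ in (r - s)..(r + s), |F (ρ • e)| * ρ ^ (m + 1) := by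
      have := intervalIntegral.integral_comp_add_left (a := -s) (b := s)
        (fun ρ => |F (ρ • e)| * ρ ^ (m + 1)) r
      rw [this, sub_eq_add_neg]
    have hb : ∀ i ∈ Finset.range (m+1), |LL (w i) (m + i - m) s| ≤
        (m.choose i : ℝ) * (c / r ^ (m + 1) *
          ∫ ρ in (r - s)..(r + s), |F (ρ • e)| * ρ ^ (m + 1)) := by
      intro i hi
      have hi : i ≤ m := by simpa [Nat.lt_succ_iff] using hi
      rw [Nat.add_sub_cancel_left, LL, ← hI, ← intervalIntegral.integral_const_mul,
        ← intervalIntegral.integral_const_mul]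
      refine (intervalIntegral.abs_integral_le_integral_abs (by linarith)).trans ?_
      refine intervalIntegral.integral_mono_on (by linarith) ?_ ?_ ?_
      · exact Continuous.intervalIntegrable (by fun_prop) _ _
      · exact Continuous.intervalIntegrable (by fun_prop) _ _
      intro y hy
      have hρ : 0 < r + y := by linarith [hy.1]
      have h1 : 0 ≤ s ^ 2 - y ^ 2 := by nlinarith [hy.1, hy.2]
      have h2 : s ^ 2 - y ^ 2 ≤ 4 * r * (r + y) := by nlinarith [hy.1, hy.2]
      have h3 : (4 * r * (r + y)) ^ (m - i) * (s ^ 2 - y ^ 2) ^ i ≤ (4 * r * (r + y)) ^ m := by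
        calc _ ≤ (4 * r * (r + y)) ^ (m - i) * (4 * r * (r + y)) ^ i := by gcongr
          _ = _ := by rw [← pow_add]; congr 1; omega
      simp only [hw, abs_mul, abs_pow, abs_neg, abs_one, one_pow, mul_one]
      rw [abs_of_nonneg h1, abs_of_pos hρ, abs_of_nonneg (show 0 ≤ c / r by positivity), abs_of_pos hr0,
        abs_of_pos (show (0:ℝ) < 4 by norm_num), abs_of_nonneg (show (0:ℝ) ≤ m.choose i by positivity),
        abs_of_pos (show 0 < 1 / (4 * r ^ 2) by positivity)]
      calc _ = (m.choose i : ℝ) * (c / r * (|F ((r + y) • e)| * (r + y) * (1 / (4 * r ^ 2)) ^ m)) *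
            ((4 * r * (r + y)) ^ (m - i) * (s ^ 2 - y ^ 2) ^ i) := by ring
        _ ≤ (m.choose i : ℝ) * (c / r * (|F ((r + y) • e)| * (r + y) * (1 / (4 * r ^ 2)) ^ m)) *
            (4 * r * (r + y)) ^ m := by gcongr
        _ = _ := by
          have : (1 / (4 * r ^ 2)) ^ m * (4 * r * (r + y)) ^ m = (r + y) ^ m / r ^ m := by
            rw [← mul_pow, ← div_pow]; congr 1; field_simp
          calc _ = (m.choose i : ℝ) * (c / r * (|F ((r + y) • e)| * (r + y))) * 
              ((1 / (4 * r ^ 2)) ^ m * (4 * r * (r + y)) ^ m) := by ring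
            _ = _ := by rw [this]; field_simp; ring
    calc _ ≤ ∑ i ∈ Finset.range (m+1), |(2:ℝ) ^ m * ((m + i).descFactorial m : ℝ) *
          LL (w i) (m + i - m) s| := Finset.abs_sum_le_sum_abs _ _
      _ ≤ ∑ i ∈ Finset.range (m+1), (2:ℝ) ^ m * ((m + i).descFactorial m : ℝ) *
        ((m.choose i : ℝ) * (c / r ^ (m + 1) *
          ∫ ρ in (r - s)..(r + s), |F (ρ • e)| * ρ ^ (m + 1))) := by
        refine Finset.sum_le_sum fun i hi => ?_
        rw [abs_mul, abs_of_nonneg (show 0 ≤ (2:ℝ) ^ m * ((m + i).descFactorial m : ℝ) by positivity)]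
        exact mul_le_mul_of_nonneg_left (hb i hi) (by positivity)
      _ = _ := by
        rw [hA]
        simp only [← mul_assoc]
        rw [← Finset.sum_mul, ← Finset.sum_mul]
        ring
  · intro s hs
    rw [hmean s hs, ← intervalIntegral.integral_const_mul]
    simp only [LL]
    rw [← intervalIntegral.integral_finsetSum]
    · refine intervalIntegral.integral_congr fun y _ => ?_
      simp only [hw]
      rw [mul_div_assoc (s ^ 2 - y ^ 2)]
      rw [sub_eq_neg_add (4 * r * (r + y)), show (s ^ 2 - y ^ 2) * ((-(s ^ 2 - y ^ 2) + 4 * r * (r + y)) / (4 * r ^ 2)) =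
        (s ^ 2 - y ^ 2) * (1 / (4 * r ^ 2)) * (-(s ^ 2 - y ^ 2) + 4 * r * (r + y)) by ring, mul_pow, add_pow,
        Finset.mul_sum, Finset.mul_sum, Finset.mul_sum]
      refine Finset.sum_congr rfl fun i _ => ?_
      rw [neg_pow (s ^ 2 - y ^ 2) i, mul_pow, pow_add]
      ring
    · intro i _
      exact Continuous.intervalIntegrable (by have := hwc i; fun_prop) _ _

lemma lint_rpow_Ioi (a c : ℝ) (ha : a < -1) (hc : 0 < c) :
    ∫⁻ x in Ioi c, ENNReal.ofReal (x ^ a) = ENNReal.ofReal (c ^ (a + 1) / (-(a + 1))) := by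
  rw [← ofReal_integral_eq_lintegral_ofReal (integrableOn_Ioi_rpow_of_lt ha hc)]
  · rw [integral_Ioi_rpow_of_lt ha hc]
    congr 1
    rw [div_neg, neg_div]
  · filter_upwards [ae_restrict_mem measurableSet_Ioi] with x hx
    exact Real.rpow_nonneg (hc.trans hx).le _

lemma lint_shift_Ioi (g : ℝ → ℝ≥0∞) (K : ℝ) :
    ∫⁻ τ in Ioi 0, g (τ + K) = ∫⁻ y in Ioi K, g y := by
  rw [← lintegral_indicator measurableSet_Ioi, ← lintegral_indicator measurableSet_Ioi,
    ← lintegral_add_right_eq_self ((Ioi K).indicator g) K]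
  refine lintegral_congr fun τ => ?_
  by_cases h : 0 < τ <;> simp [indicator, h]

lemma hardy_holder (p ε : ℝ) (hp : 1 ≤ p) (hε : 0 < ε) : ∃ C : ℝ, 0 ≤ C ∧ ∀ K : ℝ, 0 < K →
    ∀ N : ℝ → ℝ≥0∞, Measurable N →
    ∫⁻ τ in Ioi 0, N τ * ENNReal.ofReal ((τ + K) ^ (-(1 - 1 / p) - ε)) ≤
      ENNReal.ofReal (C * K ^ (-ε)) * (∫⁻ τ in Ioi 0, N τ ^ p) ^ (1 / p) := by
  rcases hp.eq_or_lt with rfl | hp1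
  · refine ⟨1, zero_le_one, fun K hK N hN => ?_⟩
    have : ∀ τ ∈ Ioi (0:ℝ), N τ * ENNReal.ofReal ((τ + K) ^ (-(1 - 1 / (1:ℝ)) - ε)) ≤
        ENNReal.ofReal (1 * K ^ (-ε)) * N τ := by
      intro τ hτ
      rw [mul_comm]
      gcongr
      rw [one_mul, show (-(1 - 1 / (1:ℝ)) - ε) = -ε by norm_num]
      exact Real.rpow_le_rpow_of_nonpos hK (by linarith [show (0:ℝ) < τ from hτ]) (by linarith)
    refine (setLIntegral_mono (by fun_prop) this).trans ?_
    rw [lintegral_const_mul _ hN]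
    simp
  · set p' := p.conjExponent with hp'
    have hpp : p.HolderConjugate p' := Real.HolderConjugate.conjExponent hp1
    have hp'0 : 0 < p' := hpp.symm.pos
    have h1p : 1 - 1 / p = 1 / p' := by
      have := hpp.inv_add_inv_eq_one
      rw [one_div, one_div]; linarith
    refine ⟨(1 / (ε * p')) ^ (1 / p'), by positivity, fun K hK N hN => ?_⟩
    refine (ENNReal.lintegral_mul_le_Lp_mul_Lq _ hpp hN.aemeasurable (by fun_prop)).trans ?_
    rw [mul_comm]
    gcongr
    rw [h1p]
    have : ∫⁻ τ in Ioi (0:ℝ), ENNReal.ofReal ((τ + K) ^ (-(1 / p') - ε)) ^ p' =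
        ∫⁻ τ in Ioi (0:ℝ), (fun y => ENNReal.ofReal (y ^ (-(1 + ε * p')))) (τ + K) := by
      refine setLIntegral_congr_fun measurableSet_Ioi fun τ hτ => ?_
      have h0 : 0 < τ + K := by linarith [show (0:ℝ) < τ from hτ]
      simp only []
      rw [ENNReal.ofReal_rpow_of_nonneg (by positivity) hp'0.le, ← Real.rpow_mul h0.le]
      congr 2
      field_simp
      ring
    rw [this, lint_shift_Ioi (fun y => ENNReal.ofReal (y ^ (-(1 + ε * p')))) K, lint_rpow_Ioi _ _ (by nlinarith [mul_pos hε hp'0]) hK,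
      ENNReal.ofReal_rpow_of_nonneg (by
        rw [show -(-(1 + ε * p') + 1) = ε * p' by ring]; positivity) (by positivity)]
    apply le_of_eq
    congr 1
    rw [show -(-(1 + ε * p') + 1) = ε * p' by ring, show -(1 + ε * p') + 1 = - ε * p' by ring,
      div_eq_inv_mul, ← one_div, Real.mul_rpow (by positivity) (by positivity), ← Real.rpow_mul hK.le]
    congr 2
    field_simp

lemma holder_set {α : Type*} [MeasurableSpace α] (μ : Measure α) (p : ℝ) (hp : 1 ≤ p)
    (f : α → ℝ≥0∞) (hf : Measurable f) :
    ∫⁻ x, f x ∂μ ≤ (∫⁻ x, f x ^ p ∂μ) ^ (1 / p) * μ univ ^ (1 - 1 / p) := by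
  rcases hp.eq_or_lt with rfl | hp1
  · simp
  · set p' := p.conjExponent with hp'
    have hpp : p.HolderConjugate p' := Real.HolderConjugate.conjExponent hp1
    have h1p : 1 - 1 / p = 1 / p' := by
      have := hpp.inv_add_inv_eq_one
      rw [one_div, one_div]; linarith
    have := ENNReal.lintegral_mul_le_Lp_mul_Lq μ hpp hf.aemeasurable
      (measurable_const (a := (1:ℝ≥0∞))).aemeasurable
    rw [h1p]
    simpa using this

lemma inner_holder (m : ℕ) (q : ℝ) (hq : 1 ≤ q) : ∃ C : ℝ, 0 ≤ C ∧
    ∀ (F : EuclideanSpace ℝ (Fin (2 * m + 3)) → ℝ), Continuous F →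
    (∀ x y, ‖x‖ = ‖y‖ → F x = F y) → ∀ e : EuclideanSpace ℝ (Fin (2 * m + 3)), ‖e‖ = 1 →
    ∀ τ K : ℝ, 0 ≤ τ → 0 < K →
    ∫⁻ ρ in Ico (τ + K) (τ + 2 * K), ENNReal.ofReal (|F (ρ • e)| * ρ ^ (m + 1)) ≤
      ENNReal.ofReal (C * ((τ + K) ^ ((2 * m + 2) * (1 / 2 - 1 / q)) * K ^ (1 - 1 / q))) *
        (∫⁻ x, ENNReal.ofReal |F x| ^ q) ^ (1 / q) := by
  have hq0 : 0 < q := by linarith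
  set γ : ℝ := (2 * m + 2) * (1 / 2 - 1 / q) with hγ
  set c := (volume : Measure (EuclideanSpace ℝ (Fin (2 * m + 3)))).toSphere univ with hc
  have hc0 : c ≠ 0 := by
    rw [hc, Measure.measure_univ_ne_zero]; exact Measure.toSphere_ne_zero _
  have hct : c ≠ ⊤ := measure_ne_top _ _
  refine ⟨2 ^ |γ| * ((c⁻¹) ^ (1 / q)).toReal, by positivity, fun F hF hrad e he τ K hτ hK => ?_⟩
  have hFr : Continuous fun ρ : ℝ => F (ρ • e) := hF.comp (by fun_prop)
  have hR : 0 < τ + K := by linarith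
  set g : ℝ → ℝ≥0∞ := fun ρ => ENNReal.ofReal (|F (ρ • e)| * ρ ^ ((2 * m + 2) / q)) with hg
  have hgm : Measurable g := by
    have := hFr.measurable
    fun_prop
  have h1 : ∀ ρ ∈ Ico (τ + K) (τ + 2 * K), ENNReal.ofReal (|F (ρ • e)| * ρ ^ (m + 1)) ≤
      ENNReal.ofReal (2 ^ |γ| * (τ + K) ^ γ) * g ρ := by
    intro ρ hρ
    have hρ0 : 0 < ρ := hR.trans_le hρ.1
    rw [hg, ← ENNReal.ofReal_mul (by positivity)]
    apply ENNReal.ofReal_le_ofReal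
    have e1 : ρ ^ (m + 1) = ρ ^ γ * ρ ^ ((2 * m + 2) / q) := by
      rw [← Real.rpow_add hρ0, ← Real.rpow_natCast]
      congr 1
      push_cast
      rw [hγ]; ring
    have e2 : ρ ^ γ ≤ 2 ^ |γ| * (τ + K) ^ γ := by
      have e3 : ρ = (ρ / (τ + K)) * (τ + K) := by field_simp
      have e4 : 1 ≤ ρ / (τ + K) := by rw [one_le_div hR]; exact hρ.1
      have e5 : ρ / (τ + K) ≤ 2 := by rw [div_le_iff₀ hR]; linarith [hρ.2]
      calc ρ ^ γ = (ρ / (τ + K)) ^ γ * (τ + K) ^ γ := by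
            rw [← Real.mul_rpow (by positivity) hR.le, ← e3]
        _ ≤ _ := by
          gcongr
          calc _ ≤ (ρ / (τ + K)) ^ |γ| := Real.rpow_le_rpow_of_exponent_le e4 (le_abs_self _)
            _ ≤ _ := Real.rpow_le_rpow (by positivity) e5 (abs_nonneg _)
    rw [e1]
    calc _ = |F (ρ • e)| * ρ ^ (((2:ℝ) * m + 2) / q) * ρ ^ γ := by ring
      _ ≤ |F (ρ • e)| * ρ ^ (((2:ℝ) * m + 2) / q) * (2 ^ |γ| * (τ + K) ^ γ) := by gcongr
      _ = _ := by ring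
  refine (setLIntegral_mono (by fun_prop) h1).trans ?_
  rw [lintegral_const_mul _ hgm]
  have h2 := holder_set (volume.restrict (Ico (τ + K) (τ + 2 * K))) q hq g hgm
  have h3 : ∫⁻ x, ENNReal.ofReal |F x| ^ q = c * ∫⁻ ρ in Ioi (0:ℝ), g ρ ^ q := by
    have := lint_radial (volume : Measure (EuclideanSpace ℝ (Fin (2 * m + 3))))
      (fun ρ => ENNReal.ofReal |F (ρ • e)| ^ q) (by have := hFr.measurable; fun_prop)
    have h4 : ∀ x, ENNReal.ofReal |F x| ^ q = ENNReal.ofReal |F (‖x‖ • e)| ^ q := by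
      intro x
      rw [hrad x (‖x‖ • e) (by simp [norm_smul, he])]
    rw [lintegral_congr h4, this]
    congr 1
    refine setLIntegral_congr_fun measurableSet_Ioi fun ρ hρ => ?_
    have hρ0 : 0 < ρ := hρ
    simp only [hg, finrank_euclideanSpace, Fintype.card_fin]
    rw [ENNReal.ofReal_mul (by positivity), ENNReal.mul_rpow_of_nonneg _ _ hq0.le,
      ENNReal.ofReal_rpow_of_nonneg (by positivity : 0 ≤ ρ ^ (((2:ℝ) * m + 2) / q)) hq0.le,
      ← Real.rpow_mul hρ0.le, div_mul_cancel₀ _ hq0.ne', mul_comm, ← Real.rpow_natCast]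
    congr 3
    rw [show 2 * m + 3 - 1 = 2 * m + 2 by omega]
    push_cast; ring
  have h5 : ∫⁻ ρ in Ico (τ + K) (τ + 2 * K), g ρ ^ q ≤ c⁻¹ * ∫⁻ x, ENNReal.ofReal |F x| ^ q := by
    rw [h3, ← mul_assoc, ENNReal.inv_mul_cancel hc0 hct, one_mul]
    refine lintegral_mono_set fun ρ hρ => hR.trans_le hρ.1
  calc _ ≤ ENNReal.ofReal (2 ^ |γ| * (τ + K) ^ γ) *
      ((c⁻¹ * ∫⁻ x, ENNReal.ofReal |F x| ^ q) ^ (1 / q) * (ENNReal.ofReal K) ^ (1 - 1 / q)) := by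
        refine mul_le_mul' le_rfl (h2.trans (mul_le_mul' (ENNReal.rpow_le_rpow h5 (by positivity)) ?_))
        rw [Measure.restrict_apply_univ, Real.volume_Ico, show τ + 2 * K - (τ + K) = K by ring]
    _ = _ := by
      have hK1 : (0:ℝ) ≤ 1 - 1 / q := by
        rw [sub_nonneg, div_le_one hq0]; exact hq
      rw [ENNReal.mul_rpow_of_nonneg _ _ (by positivity : 0 ≤ 1 / q),
        ENNReal.ofReal_rpow_of_nonneg hK.le hK1]
      have h6 : (c⁻¹) ^ (1 / q) ≠ ⊤ :=
        ENNReal.rpow_ne_top_of_nonneg (by positivity) (ENNReal.inv_ne_top.2 hc0)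
      conv_lhs => rw [← ENNReal.ofReal_toReal h6]
      rw [show 2 ^ |γ| * ((c⁻¹) ^ (1 / q)).toReal * ((τ + K) ^ γ * K ^ (1 - 1 / q)) =
        (2 ^ |γ| * (τ + K) ^ γ) * ((c⁻¹) ^ (1 / q)).toReal * K ^ (1 - 1 / q) by ring,
        ENNReal.ofReal_mul (by positivity), ENNReal.ofReal_mul (by positivity),
        ENNReal.ofReal_mul (by positivity), ENNReal.ofReal_mul (by positivity)]
      ring

lemma kernel_bound (m : ℕ) : ∃ C : ℝ, 0 ≤ C ∧
    ∀ F : EuclideanSpace ℝ (Fin (2 * m + 3)) → ℝ, Continuous F →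
    (∀ x y, ‖x‖ = ‖y‖ → F x = F y) → ∀ e : EuclideanSpace ℝ (Fin (2 * m + 3)), ‖e‖ = 1 →
    ∀ x : EuclideanSpace ℝ (Fin (2 * m + 3)), ∀ s ∈ Ioo 0 ‖x‖,
    ENNReal.ofReal |radialOp^[m] (fun s : ℝ => s ^ (2 * m + 1) *
      ∫ ω : sphere (0 : EuclideanSpace ℝ (Fin (2 * m + 3))) 1,
        F (x + s • (ω : EuclideanSpace ℝ (Fin (2 * m + 3))))
          ∂((volume : Measure (EuclideanSpace ℝ (Fin (2 * m + 3)))).toSphere)) s| ≤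
      ENNReal.ofReal (C / ‖x‖ ^ (m + 1)) * ∫⁻ ρ in Ioc (‖x‖ - s) (‖x‖ + s),
        ENNReal.ofReal (|F (ρ • e)| * ρ ^ (m + 1)) := by
  obtain ⟨C, hC, h⟩ := pointwise_bound m
  refine ⟨C, hC, fun F hF hrad e he x s hs => ?_⟩
  refine (ENNReal.ofReal_le_ofReal (h F hF hrad e he x s hs)).trans ?_
  have hc : Continuous fun ρ : ℝ => |F (ρ • e)| * ρ ^ (m + 1) := by
    have : Continuous fun ρ : ℝ => F (ρ • e) := hF.comp (by fun_prop)
    fun_prop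
  rw [ENNReal.ofReal_mul (by positivity), intervalIntegral.integral_of_le (by linarith [hs.1]),
    ofReal_integral_eq_lintegral_ofReal]
  · exact (hc.intervalIntegrable _ _).1
  · filter_upwards [ae_restrict_mem measurableSet_Ioc] with ρ hρ
    have : 0 < ρ := by linarith [hρ.1, hs.2]
    positivity

lemma duhamel_zero (m : ℕ) (F : EuclideanSpace ℝ (Fin (2 * m + 3)) → ℝ → ℝ)
    (hF : Continuous (fun z : EuclideanSpace ℝ (Fin (2 * m + 3)) × ℝ => F z.1 z.2))
    (hrad : ∀ x y t, ‖x‖ = ‖y‖ → F x t = F y t) (K : ℝ)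
    (hsupp : ∀ x t, F x t ≠ 0 → |t| + K ≤ ‖x‖ ∧ ‖x‖ < |t| + 2 * K)
    (J t : ℝ) (hJ : 0 < J) (ht : 0 ≤ t) (hK : 2 * (t + J) ≤ K)
    (x : EuclideanSpace ℝ (Fin (2 * m + 3))) (hx1 : t + J ≤ ‖x‖) (hx2 : ‖x‖ < t + 2 * J) :
    ∫ τ in (0 : ℝ)..t, (radialOp^[m] (fun s : ℝ => s ^ (2 * m + 1) *
      ∫ ω : sphere (0 : EuclideanSpace ℝ (Fin (2 * m + 3))) 1,
        F (x + s • (ω : EuclideanSpace ℝ (Fin (2 * m + 3)))) τ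
          ∂((volume : Measure (EuclideanSpace ℝ (Fin (2 * m + 3)))).toSphere))) (t - τ) = 0 := by
  obtain ⟨C, hC, h⟩ := kernel_bound m
  rw [intervalIntegral.integral_of_le ht, integral_Ioc_eq_integral_Ioo]
  refine setIntegral_eq_zero_of_forall_eq_zero fun τ hτ => ?_
  set e : EuclideanSpace ℝ (Fin (2 * m + 3)) := EuclideanSpace.single 0 1 with he
  have he1 : ‖e‖ = 1 := by simp [he]
  have hb := h (fun y => F y τ) (hF.comp (Continuous.prodMk_left τ)) (fun x y hxy => hrad x y τ hxy) e he1 x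
    (t - τ) ⟨by linarith [hτ.2], by linarith [hτ.1]⟩
  rw [setLIntegral_congr_fun (g := fun _ => 0) measurableSet_Ioc] at hb
  · simp only [lintegral_zero, mul_zero, nonpos_iff_eq_zero, ENNReal.ofReal_eq_zero] at hb
    exact abs_eq_zero.1 (le_antisymm hb (abs_nonneg _))
  · intro ρ hρ
    have : F (ρ • e) τ = 0 := by
      by_contra hne
      have h1 := (hsupp _ _ hne).1
      have hρ0 : 0 < ρ := by linarith [hρ.1, hτ.1]
      rw [norm_smul, he1, mul_one, Real.norm_of_nonneg hρ0.le, abs_of_pos hτ.1] at h1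
      linarith [hρ.2, hτ.1]
    simp [this]

lemma duhamel_bound (m : ℕ) (pt qt κ' : ℝ) (hpt : 1 ≤ pt) (hqt : 1 ≤ qt) (hκ0 : 0 ≤ κ')
    (hκ : (2 * m + 2) * (1 / 2 - 1 / qt) + 1 - 1 / pt < κ') : ∃ C : ℝ, 0 ≤ C ∧
    ∀ F : EuclideanSpace ℝ (Fin (2 * m + 3)) → ℝ → ℝ,
    Continuous (fun z : EuclideanSpace ℝ (Fin (2 * m + 3)) × ℝ => F z.1 z.2) →
    (∀ x y t, ‖x‖ = ‖y‖ → F x t = F y t) → ∀ K : ℝ, 0 < K →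
    (∀ x t, F x t ≠ 0 → |t| + K ≤ ‖x‖ ∧ ‖x‖ < |t| + 2 * K) →
    ∀ J t : ℝ, 0 < J → 0 ≤ t → K < 2 * (t + J) →
    ∀ x : EuclideanSpace ℝ (Fin (2 * m + 3)), t + J ≤ ‖x‖ → ‖x‖ < t + 2 * J →
    ENNReal.ofReal |∫ τ in (0 : ℝ)..t, (radialOp^[m] (fun s : ℝ => s ^ (2 * m + 1) *
      ∫ ω : sphere (0 : EuclideanSpace ℝ (Fin (2 * m + 3))) 1,
        F (x + s • (ω : EuclideanSpace ℝ (Fin (2 * m + 3)))) τ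
          ∂((volume : Measure (EuclideanSpace ℝ (Fin (2 * m + 3)))).toSphere))) (t - τ)| ≤
    ENNReal.ofReal (C * ((t + J) ^ (κ' - (m + 1)) * K ^ (1 - 1 / qt) *
      K ^ ((2 * m + 2) * (1 / 2 - 1 / qt) + 1 - 1 / pt - κ'))) *
        mixedNorm (2 * m + 3) pt qt univ F := by
  obtain ⟨C1, hC1, h1⟩ := kernel_bound m
  obtain ⟨C2, hC2, h2⟩ := inner_holder m qt hqt
  set γ : ℝ := (2 * m + 2) * (1 / 2 - 1 / qt) with hγ
  obtain ⟨C3, hC3, h3⟩ := hardy_holder pt (κ' - (γ + 1 - 1 / pt)) hpt (by linarith)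
  refine ⟨C1 * C2 * 3 ^ κ' * C3, by positivity, ?_⟩
  intro F hF hrad K hK hsupp J t hJ ht hKT x hx1 hx2
  set T := t + J with hT
  have hT0 : 0 < T := by positivity
  have hqt0 : 0 < qt := by linarith
  have hpt0 : 0 < pt := by linarith
  set N : ℝ → ℝ≥0∞ := fun τ => (∫⁻ x, ENNReal.ofReal |F x τ| ^ qt) ^ (1 / qt) with hN
  have hNm : Measurable N := by
    have hm : Measurable fun z : ℝ × EuclideanSpace ℝ (Fin (2 * m + 3)) =>
        ENNReal.ofReal |F z.2 z.1| ^ qt := by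
      have : Measurable fun z : ℝ × EuclideanSpace ℝ (Fin (2 * m + 3)) => F z.2 z.1 :=
        (hF.comp (by fun_prop : Continuous fun z : ℝ × EuclideanSpace ℝ (Fin (2 * m + 3)) =>
          (z.2, z.1))).measurable
      have h5 := this.abs
      fun_prop
    exact (hm.lintegral_prod_right').pow_const _
  have hX : mixedNorm (2 * m + 3) pt qt univ F = (∫⁻ τ, N τ ^ pt) ^ (1 / pt) := by
    rw [mixedNorm, Measure.restrict_univ]
    congr 1
    refine lintegral_congr fun τ => ?_
    rw [hN, ← ENNReal.rpow_mul]
    congr 1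
    ring
  have hXle : (∫⁻ τ in Ioi (0:ℝ), N τ ^ pt) ^ (1 / pt) ≤ mixedNorm (2 * m + 3) pt qt univ F := by
    rw [hX]
    exact ENNReal.rpow_le_rpow (setLIntegral_le_lintegral _ _) (by positivity)
  set D : ℝ := C1 / T ^ (m + 1) * (C2 * (K ^ (1 - 1 / qt) * (3 * T) ^ κ')) with hD
  have hD0 : 0 ≤ D := by positivity
  set e : EuclideanSpace ℝ (Fin (2 * m + 3)) := EuclideanSpace.single 0 1 with he
  have he1 : ‖e‖ = 1 := by simp [he]
  have key : ∀ τ ∈ Ioo 0 t, ‖(radialOp^[m] (fun s : ℝ => s ^ (2 * m + 1) *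
      ∫ ω : sphere (0 : EuclideanSpace ℝ (Fin (2 * m + 3))) 1,
        F (x + s • (ω : EuclideanSpace ℝ (Fin (2 * m + 3)))) τ
          ∂((volume : Measure (EuclideanSpace ℝ (Fin (2 * m + 3)))).toSphere))) (t - τ)‖ₑ ≤
      ENNReal.ofReal D * (N τ * ENNReal.ofReal ((τ + K) ^ (-(1 - 1 / pt) - (κ' - (γ + 1 - 1 / pt))))) := by
    intro τ hτ
    have hτ0 : 0 < τ := hτ.1
    have hFc : Continuous fun y => F y τ := hF.comp (Continuous.prodMk_left τ)
    have hFr : ∀ x y, ‖x‖ = ‖y‖ → F x τ = F y τ := fun x y hxy => hrad x y τ hxy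
    have hb := h1 (fun y => F y τ) hFc hFr e he1 x
      (t - τ) ⟨by linarith [hτ.2], by linarith [hτ.1]⟩
    have hi := h2 (fun y => F y τ) hFc hFr e he1 τ K hτ0.le hK
    rw [Real.enorm_eq_ofReal_abs]
    refine hb.trans ?_
    have hsub : ∫⁻ ρ in Ioc (‖x‖ - (t - τ)) (‖x‖ + (t - τ)),
        ENNReal.ofReal (|F (ρ • e) τ| * ρ ^ (m + 1)) ≤
        ∫⁻ ρ in Ico (τ + K) (τ + 2 * K), ENNReal.ofReal (|F (ρ • e) τ| * ρ ^ (m + 1)) := by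
      rw [← lintegral_indicator measurableSet_Ioc, ← lintegral_indicator measurableSet_Ico]
      refine lintegral_mono fun ρ => ?_
      by_cases hρ : ρ ∈ Ioc (‖x‖ - (t - τ)) (‖x‖ + (t - τ))
      · by_cases hz : F (ρ • e) τ = 0
        · simp [indicator, hz]
        · have hs := hsupp _ _ hz
          have hρ0 : 0 < ρ := by linarith [hρ.1, hτ.1]
          rw [norm_smul, he1, mul_one, Real.norm_of_nonneg hρ0.le, abs_of_pos hτ.1] at hs
          rw [indicator_of_mem hρ, indicator_of_mem (show ρ ∈ Ico _ _ from hs)]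
      · rw [indicator_of_notMem hρ]
        exact zero_le
    refine (mul_le_mul' le_rfl (hsub.trans hi)).trans ?_
    have hR : 0 < τ + K := by positivity
    rw [show -(1 - 1 / pt) - (κ' - (γ + 1 - 1 / pt)) = γ - κ' by ring, mul_comm (N τ),
      ← mul_assoc (ENNReal.ofReal (C1 / ‖x‖ ^ (m + 1))), ← mul_assoc (ENNReal.ofReal D), ← ENNReal.ofReal_mul (by positivity), ← ENNReal.ofReal_mul hD0]
    refine mul_le_mul' (ENNReal.ofReal_le_ofReal ?_) le_rfl
    have e1 : (τ + K) ^ γ = (τ + K) ^ κ' * (τ + K) ^ (γ - κ') := by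
      rw [← Real.rpow_add hR]; congr 1; ring
    have e2 : (τ + K) ^ κ' ≤ (3 * T) ^ κ' :=
      Real.rpow_le_rpow hR.le (by linarith [hτ.2]) hκ0
    have e3 : C1 / ‖x‖ ^ (m + 1) ≤ C1 / T ^ (m + 1) := by gcongr
    calc _ ≤ C1 / T ^ (m + 1) * (C2 * ((3 * T) ^ κ' * (τ + K) ^ (γ - κ') * K ^ (1 - 1 / qt))) := by
          rw [e1]
          gcongr
      _ = _ := by rw [hD]; ring
  rw [intervalIntegral.integral_of_le ht, integral_Ioc_eq_integral_Ioo, ← Real.enorm_eq_ofReal_abs]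
  refine (enorm_integral_le_lintegral_enorm _).trans ?_
  refine (setLIntegral_mono' measurableSet_Ioo key).trans ?_
  refine (lintegral_mono_set (fun τ hτ => hτ.1 : Ioo 0 t ⊆ Ioi 0)).trans ?_
  rw [lintegral_const_mul _ (by fun_prop)]
  refine (mul_le_mul' le_rfl ((h3 K hK N hNm).trans (mul_le_mul' le_rfl hXle))).trans ?_
  rw [← mul_assoc, ← ENNReal.ofReal_mul hD0]
  refine mul_le_mul' (ENNReal.ofReal_le_ofReal (le_of_eq ?_)) le_rfl
  rw [hD, show κ' - ((m:ℝ) + 1) = κ' - ((m + 1 : ℕ) : ℝ) by push_cast; ring,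
    Real.rpow_sub hT0, Real.rpow_natCast, Real.mul_rpow (by norm_num) hT0.le,
    show -(κ' - (γ + 1 - 1 / pt)) = γ + 1 - 1 / pt - κ' by ring]
  ring

lemma annulus_vol (m : ℕ) : ∃ c : ℝ, 0 ≤ c ∧ ∀ T J : ℝ, 0 < J → J ≤ T →
    volume {x : EuclideanSpace ℝ (Fin (2 * m + 3)) | ‖x‖ ∈ Ico T (T + J)} ≤
      ENNReal.ofReal (c * (T ^ (2 * m + 2) * J)) := by
  set c := (volume : Measure (EuclideanSpace ℝ (Fin (2 * m + 3)))).toSphere univ with hc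
  have hct : c ≠ ⊤ := measure_ne_top _ _
  refine ⟨c.toReal * 2 ^ (2 * m + 2), by positivity, fun T J hJ hJT => ?_⟩
  have hT : 0 < T := hJ.trans_le hJT
  have hms : MeasurableSet {x : EuclideanSpace ℝ (Fin (2 * m + 3)) | ‖x‖ ∈ Ico T (T + J)} :=
    measurable_norm measurableSet_Ico
  have h := lint_radial (volume : Measure (EuclideanSpace ℝ (Fin (2 * m + 3))))
    ((Ico T (T + J)).indicator 1) (measurable_one.indicator measurableSet_Ico)
  have h1 : volume {x : EuclideanSpace ℝ (Fin (2 * m + 3)) | ‖x‖ ∈ Ico T (T + J)} =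
      ∫⁻ y : EuclideanSpace ℝ (Fin (2 * m + 3)), (Ico T (T + J)).indicator 1 ‖y‖ := by
    rw [← lintegral_indicator_one hms]
    rfl
  rw [h1, h]
  have h2 : ∫⁻ r in Ioi (0:ℝ), ENNReal.ofReal (r ^ (Module.finrank ℝ (EuclideanSpace ℝ (Fin (2 * m + 3))) - 1)) *
      (Ico T (T + J)).indicator 1 r ≤ ENNReal.ofReal ((2 * T) ^ (2 * m + 2)) * ENNReal.ofReal J := by
    calc _ ≤ ∫⁻ r : ℝ, ENNReal.ofReal ((2 * T) ^ (2 * m + 2)) * (Ico T (T + J)).indicator 1 r := by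
          refine (setLIntegral_le_lintegral _ _).trans (lintegral_mono fun r => ?_)
          by_cases hr : r ∈ Ico T (T + J)
          · simp only [finrank_euclideanSpace, Fintype.card_fin]
            rw [show 2 * m + 3 - 1 = 2 * m + 2 by omega]
            refine mul_le_mul' (ENNReal.ofReal_le_ofReal ?_) le_rfl
            have : 0 < r := hT.trans_le hr.1
            exact pow_le_pow_left₀ this.le (by linarith [hr.2]) _
          · simp [hr]
      _ = _ := by
          rw [lintegral_const_mul _ (measurable_one.indicator measurableSet_Ico),
            lintegral_indicator_one measurableSet_Ico, Real.volume_Ico]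
          congr 2
          ring
  refine (mul_le_mul' le_rfl h2).trans (le_of_eq ?_)
  rw [← hc, ← ENNReal.ofReal_toReal hct, ← ENNReal.ofReal_mul (by positivity),
    ← ENNReal.ofReal_mul (by positivity), ENNReal.toReal_ofReal (by positivity), mul_pow]
  congr 1
  ring

lemma final_est (m : ℕ) (p q σ : ℝ) (hp : 1 ≤ p) (hq : 1 ≤ q)
    (hσ : (σ + (2 * m + 2) / q) * p < -1) : ∃ C : ℝ, 0 ≤ C ∧
    ∀ (j : ℤ) (J K : ℝ), J = (2:ℝ) ^ j → 0 < K →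
    ∀ (u : EuclideanSpace ℝ (Fin (2 * m + 3)) → ℝ → ℝ) (X : ℝ≥0∞) (B : ℝ), 0 ≤ B →
    (∀ t, 0 ≤ t → K < 2 * (t + J) → ∀ x, t + J ≤ ‖x‖ → ‖x‖ < t + 2 * J →
      ENNReal.ofReal |u x t| ≤ ENNReal.ofReal (B * (t + J) ^ σ) * X) →
    (∀ t, 0 ≤ t → 2 * (t + J) ≤ K → ∀ x, t + J ≤ ‖x‖ → ‖x‖ < t + 2 * J → u x t = 0) →
    mixedNorm (2 * m + 3) p q (Ici (0:ℝ)) (chiO (2 * m + 3) j u) ≤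
      ENNReal.ofReal (C * (B * J ^ (1 / q) * K ^ (σ + (2 * m + 2) / q + 1 / p))) * X := by
  obtain ⟨c, hc, hvol⟩ := annulus_vol m
  have hq0 : 0 < q := by linarith
  have hp0 : 0 < p := by linarith
  set a : ℝ := σ + (2 * m + 2) / q with ha
  have ha1 : 0 < -(a * p + 1) := by linarith
  refine ⟨c ^ (1 / q) * ((1 / 2) ^ (a * p + 1) / (-(a * p + 1))) ^ (1 / p), by positivity, ?_⟩
  intro j J K hJ hK u X B hB hu1 hu0
  have hJ0 : 0 < J := by rw [hJ]; positivity
  set D : ℝ := c ^ (1 / q) * B * J ^ (1 / q) with hD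
  have hD0 : 0 ≤ D := by positivity
  set g : ℝ → ℝ≥0∞ := fun y => (Ioi (K / 2)).indicator
    (fun y => ENNReal.ofReal (y ^ (a * p))) y with hg
  have hgm : Measurable g := by
    exact (by fun_prop : Measurable fun y : ℝ => ENNReal.ofReal (y ^ (a * p))).indicator
      measurableSet_Ioi
  have key : ∀ t ∈ Ici (0:ℝ), (∫⁻ x, ENNReal.ofReal |chiO (2 * m + 3) j u x t| ^ q) ^ (p / q) ≤
      (ENNReal.ofReal D * X) ^ p * g (t + J) := by
    intro t ht
    have ht0 : 0 ≤ t := ht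
    have hT : 0 < t + J := by positivity
    have hj2 : (2:ℝ) ^ (j + 1) = 2 * J := by rw [hJ, zpow_add_one₀ (by norm_num)]; ring
    by_cases hKT : K < 2 * (t + J)
    · have hle : ∫⁻ x, ENNReal.ofReal |chiO (2 * m + 3) j u x t| ^ q ≤
          (ENNReal.ofReal (B * (t + J) ^ σ) * X) ^ q *
            ENNReal.ofReal (c * ((t + J) ^ (2 * m + 2) * J)) := by
        refine le_trans ?_ (mul_le_mul' le_rfl (hvol (t + J) J hJ0 (by linarith)))
        have hms : MeasurableSet {x : EuclideanSpace ℝ (Fin (2 * m + 3)) |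
          ‖x‖ ∈ Ico (t + J) (t + J + J)} := measurable_norm measurableSet_Ico
        rw [← lintegral_indicator_const hms]
        refine lintegral_mono fun x => ?_
        by_cases hx : ‖x‖ ∈ Ico (t + J) (t + J + J)
        · rw [indicator_of_mem (show x ∈ {x | ‖x‖ ∈ Ico (t + J) (t + J + J)} from hx)]
          refine ENNReal.rpow_le_rpow ?_ hq0.le
          rw [chiO, abs_of_nonneg ht0, ← hJ, hj2, if_pos ⟨hx.1, by linarith [hx.2]⟩]
          exact hu1 t ht0 hKT x hx.1 (by linarith [hx.2])
        · rw [chiO, abs_of_nonneg ht0, ← hJ, hj2, if_neg]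
          · simp [hq0]
          · rintro ⟨h1, h2⟩
            exact hx ⟨h1, by linarith⟩
      have hgt : g (t + J) = ENNReal.ofReal ((t + J) ^ (a * p)) := by
        rw [hg]
        exact indicator_of_mem (show t + J ∈ Ioi (K / 2) by
          rw [mem_Ioi]; linarith) _
      refine (ENNReal.rpow_le_rpow hle (by positivity)).trans (le_of_eq ?_)
      rw [hgt, show p / q = 1 / q * p by ring, ENNReal.rpow_mul,
        ENNReal.mul_rpow_of_nonneg _ _ (by positivity : 0 ≤ 1 / q), ← ENNReal.rpow_mul,
        show q * (1 / q) = 1 by field_simp, ENNReal.rpow_one,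
        Real.rpow_mul hT.le, ← ENNReal.ofReal_rpow_of_nonneg (by positivity) hp0.le,
        ← ENNReal.mul_rpow_of_nonneg _ _ hp0.le,
        ENNReal.ofReal_rpow_of_nonneg (by positivity) (by positivity : 0 ≤ 1 / q)]
      congr 1
      rw [mul_right_comm, mul_right_comm (ENNReal.ofReal D), ← ENNReal.ofReal_mul (by positivity),
        ← ENNReal.ofReal_mul (by positivity)]
      congr 2
      rw [hD, ha, Real.rpow_add hT, Real.mul_rpow hc (by positivity),
        Real.mul_rpow (by positivity) hJ0.le, ← Real.rpow_natCast, ← Real.rpow_mul hT.le]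
      push_cast
      rw [show ((2:ℝ) * m + 2) * (1 / q) = (2 * m + 2) / q by ring]
      ring
    · have : ∀ x, ENNReal.ofReal |chiO (2 * m + 3) j u x t| ^ q = 0 := by
        intro x
        have : chiO (2 * m + 3) j u x t = 0 := by
          rw [chiO, abs_of_nonneg ht0, ← hJ, hj2]
          split_ifs with h
          · exact hu0 t ht0 (not_lt.1 hKT) x h.1 h.2
          · rfl
        simp [this, hq0]
      simp [this, hp0, hq0]
  have htime : ∫⁻ t in Ici (0:ℝ), (∫⁻ x, ENNReal.ofReal |chiO (2 * m + 3) j u x t| ^ q) ^ (p / q) ≤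
      (ENNReal.ofReal D * X) ^ p * ENNReal.ofReal ((K / 2) ^ (a * p + 1) / (-(a * p + 1))) := by
    refine (setLIntegral_mono' measurableSet_Ici key).trans ?_
    refine (setLIntegral_le_lintegral _ _).trans ?_
    rw [lintegral_const_mul _ (by fun_prop), lintegral_add_right_eq_self g J, hg,
      lintegral_indicator measurableSet_Ioi, lint_rpow_Ioi _ _ hσ (by positivity)]
  rw [mixedNorm]
  refine (ENNReal.rpow_le_rpow htime (by positivity)).trans (le_of_eq ?_)
  rw [ENNReal.mul_rpow_of_nonneg _ _ (by positivity : 0 ≤ 1 / p), ← ENNReal.rpow_mul,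
    show p * (1 / p) = 1 by field_simp, ENNReal.rpow_one,
    ENNReal.ofReal_rpow_of_nonneg (by positivity) (by positivity), mul_right_comm,
    ← ENNReal.ofReal_mul hD0]
  congr 2
  rw [show K / 2 = 1 / 2 * K by ring, Real.mul_rpow (by norm_num) hK.le, mul_div_right_comm,
    Real.mul_rpow (by positivity) (by positivity), ← Real.rpow_mul hK.le,
    show (a * p + 1) * (1 / p) = a + 1 / p by field_simp, hD]
  ring

/-- Channel-localized inhomogeneous estimate: if `F` is supported in
`Ω_k` then the Duhamel term satisfies
`‖χ_j u‖_{L^p L^q([0,∞) × ℝ^d)} ≤ C 2^{(j-k)/q} ‖F‖_{L^p̃ L^q̃}` for `j ≤ k`. -/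
theorem stmt17 (d : ℕ) (hd : 3 ≤ d) (hodd : Odd d) (β p q pt qt : ℝ)
    (hβ : β ∈ Ioo (1 / 2 : ℝ) (3 / 2)) (hp : 1 ≤ p) (hq : 1 ≤ q) (hpt : 1 ≤ pt)
    (hqt : 1 ≤ qt) (hpq : 1 / p + (d : ℝ) / q = (d : ℝ) / 2 - β)
    (hptqt : 1 / pt + (d : ℝ) / qt = (d : ℝ) / 2 - β + 2) :
    ∃ C : ℝ, ∀ j k : ℤ, j ≤ k →
      ∀ F : EuclideanSpace ℝ (Fin d) → ℝ → ℝ,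
        Continuous (fun z : EuclideanSpace ℝ (Fin d) × ℝ => F z.1 z.2) →
        (∀ x y t, ‖x‖ = ‖y‖ → F x t = F y t) →
        (∀ x t, F x t ≠ 0 → |t| + (2 : ℝ) ^ k ≤ ‖x‖ ∧ ‖x‖ < |t| + (2 : ℝ) ^ (k + 1)) →
        mixedNorm d pt qt univ F < ⊤ →
        mixedNorm d p q (Ici (0 : ℝ)) (chiO d j (fun x t =>
            ∫ τ in (0 : ℝ)..t,
              (radialOp^[(d - 3) / 2] (fun s : ℝ => s ^ (d - 2) *
                ∫ ω : sphere (0 : EuclideanSpace ℝ (Fin d)) 1,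
                  F (x + s • (ω : EuclideanSpace ℝ (Fin d))) τ
                  ∂((volume : Measure (EuclideanSpace ℝ (Fin d))).toSphere))) (t - τ)))
          ≤ ENNReal.ofReal (C * (2 : ℝ) ^ (((j : ℝ) - (k : ℝ)) / q)) *
              mixedNorm d pt qt univ F := by
  obtain ⟨m, rfl⟩ : ∃ m, d = 2 * m + 3 := by
    obtain ⟨n, hn⟩ := hodd
    exact ⟨n - 1, by omega⟩
  rw [show (2 * m + 3 - 3) / 2 = m by omega, show 2 * m + 3 - 2 = 2 * m + 1 by omega]
  push_cast at hpq hptqt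
  obtain ⟨hβ1, hβ2⟩ := hβ
  have hq0 : 0 < q := by linarith
  have hp0 : 0 < p := by linarith
  have hqt1 : 1 / qt ≤ 1 := by rw [div_le_one (by linarith)]; exact hqt
  have hq1 : 0 < 1 / q := by positivity
  have hκ : (2 * m + 2) * (1 / 2 - 1 / qt) + 1 - 1 / pt = β - 3 / 2 + 1 / qt := by
    linear_combination (-1 : ℝ) * hptqt
  have hθ : (2 * m + 2) * (1 / 2 - 1 / q) - 1 / p = β - 1 / 2 + 1 / q := by
    linear_combination (-1 : ℝ) * hpq
  obtain ⟨κ', hκ0, hκ1, hκ2⟩ : ∃ κ' : ℝ, 0 ≤ κ' ∧ β - 3 / 2 + 1 / qt < κ' ∧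
      κ' < β - 1 / 2 + 1 / q := by
    obtain ⟨κ', h1, h2⟩ := exists_between (show max 0 (β - 3 / 2 + 1 / qt) < β - 1 / 2 + 1 / q from
      max_lt (by linarith) (by linarith))
    exact ⟨κ', (le_max_left _ _).trans h1.le, (le_max_right _ _).trans_lt h1, h2⟩
  obtain ⟨C1, hC1, h1⟩ := duhamel_bound m pt qt κ' hpt hqt hκ0 (by rw [hκ]; exact hκ1)
  have hexp : κ' - (m + 1) + (2 * m + 2) / q + 1 / p = κ' - (β - 1 / 2 + 1 / q) := by
    linear_combination hpq
  obtain ⟨C2, hC2, h2⟩ := final_est m p q (κ' - (m + 1)) hp hq (by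
    have h3 : κ' - (m + 1) + (2 * m + 2) / q < - (1 / p) := by linarith
    calc _ < - (1 / p) * p := mul_lt_mul_of_pos_right h3 hp0
      _ = -1 := by field_simp)
  refine ⟨C2 * C1, fun j k hjk F hF hrad hsupp _ => ?_⟩
  have hK : (0:ℝ) < 2 ^ k := by positivity
  have hJ : (0:ℝ) < 2 ^ j := by positivity
  have hsupp' : ∀ x t, F x t ≠ 0 → |t| + (2 : ℝ) ^ k ≤ ‖x‖ ∧ ‖x‖ < |t| + 2 * (2 : ℝ) ^ k := by
    intro x t hx
    have := hsupp x t hx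
    rwa [zpow_add_one₀ (by norm_num), mul_comm ((2:ℝ) ^ k)] at this
  set B : ℝ := C1 * (((2:ℝ) ^ k) ^ (1 - 1 / qt) * ((2:ℝ) ^ k) ^ (β - 3 / 2 + 1 / qt - κ')) with hB
  refine (h2 j (2 ^ j) (2 ^ k) rfl hK _ (mixedNorm (2 * m + 3) pt qt univ F) B (by positivity)
    ?_ ?_).trans ?_
  · intro t ht hKT x hx1 hx2
    refine (h1 F hF hrad (2 ^ k) hK hsupp' (2 ^ j) t hJ ht hKT x hx1 hx2).trans (le_of_eq ?_)
    rw [hκ, hB]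
    congr 2
    ring
  · intro t ht hKT x hx1 hx2
    exact duhamel_zero m F hF hrad (2 ^ k) hsupp' (2 ^ j) t hJ ht hKT x hx1 hx2
  · refine mul_le_mul' (ENNReal.ofReal_le_ofReal (le_of_eq ?_)) le_rfl
    rw [hexp, hB]
    have e1 : ((2:ℝ) ^ k) ^ (1 - 1 / qt) * ((2:ℝ) ^ k) ^ (β - 3 / 2 + 1 / qt - κ') *
        ((2:ℝ) ^ k) ^ (κ' - (β - 1 / 2 + 1 / q)) = ((2:ℝ) ^ k) ^ (- (1 / q)) := by
      rw [← Real.rpow_add hK, ← Real.rpow_add hK]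
      congr 1
      ring
    have e2 : (2:ℝ) ^ (((j : ℝ) - (k : ℝ)) / q) = ((2:ℝ) ^ j) ^ (1 / q) * ((2:ℝ) ^ k) ^ (- (1 / q)) := by
      rw [← Real.rpow_intCast, ← Real.rpow_intCast, ← Real.rpow_mul (by norm_num),
        ← Real.rpow_mul (by norm_num), ← Real.rpow_add (by norm_num)]
      congr 1
      ring
    rw [e2, ← e1]
    ring
end
end
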